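/- Let f, g : ℝ → ℝ be infinitely differentiable, set X = f(B) and Y = g(B), and let Φ : ℝ → ℝ be the infinitely differentiable function with Φ' = f g' and Φ(0) = 0. Then for every T > 0, sup_{0 ≤ t ≤ T} | ∑_{j=1}^{⌊nt⌋} ((X(t_{j−1}) + X(t_j))/2)(Y(t_j) − Y(t_{j−1})) − Φ(B(⌊nt⌋/n)) + Φ(B(0)) − (1/12) ∑_{j=1}^{⌊nt⌋} (f'' g' − f' g'')(β_{j,n}) (ΔB_{j,n})³ | → 0 in probability as n → ∞. (This is the change-of-variable formula ∫ X dY = Φ(B) + (1/12) ∫ (f''g' − f'g'')(B) d⟦B⟧ at the level of Riemann-sum representatives.) -/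

import Mathlib

open MeasureTheory ProbabilityTheory Filter Topology

noncomputable section

/-- `B` is a fractional Brownian motion with Hurst parameter `1/6`: a centered Gaussian
process with continuous sample paths and covariance
`E[B s * B t] = (t^(1/3) + s^(1/3) - |t - s|^(1/3)) / 2` for `s, t ≥ 0`. -/
def IsFBM16 {Ω : Type*} [MeasureSpace Ω] (B : ℝ → Ω → ℝ) : Prop :=
  (∀ t : ℝ, Measurable (B t)) ∧
  (∀ ω : Ω, Continuous fun t : ℝ => B t ω) ∧
  (∀ (m : ℕ) (t : Fin m → ℝ) (c : Fin m → ℝ), (∀ i, 0 ≤ t i) →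
    ∃ v : NNReal,
      Measure.map (fun ω => ∑ i, c i * B (t i) ω) (volume : Measure Ω) = gaussianReal 0 v) ∧
  (∀ s t : ℝ, 0 ≤ s → 0 ≤ t →
    ∫ ω, B s ω * B t ω =
      (t ^ ((1 : ℝ) / 3) + s ^ ((1 : ℝ) / 3) - |t - s| ^ ((1 : ℝ) / 3)) / 2)

lemma ContDiff.exists_abs_le {f : ℝ → ℝ} (hf : ContDiff ℝ (⊤ : ℕ∞) f) (K : ℝ) (i : ℕ) :
    ∃ C, 0 ≤ C ∧ ∀ x, |x| ≤ K → |iteratedDeriv i f x| ≤ C := by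
  have hc : Continuous (iteratedDeriv i f) :=
    hf.continuous_iteratedDeriv i (by exact_mod_cast le_top)
  obtain ⟨C, hC⟩ := (isCompact_Icc (a := -K) (b := K)).exists_bound_of_continuousOn hc.continuousOn
  refine ⟨max C 0, le_max_right _ _, fun x hx => ?_⟩
  exact (hC x (abs_le.mp hx)).trans (le_max_left _ _)

lemma contDiff_deriv {f : ℝ → ℝ} (hf : ContDiff ℝ (⊤ : ℕ∞) f) :
    ContDiff ℝ (⊤ : ℕ∞) (deriv f) :=
  (contDiff_infty_iff_deriv.mp hf).2

/-- Taylor's formula with a remainder bound uniform in the base point. -/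
lemma exists_taylor_bound (k : ℕ) : ∀ {f : ℝ → ℝ}, ContDiff ℝ (⊤ : ℕ∞) f → ∀ K : ℝ,
    ∃ C, 0 ≤ C ∧ ∀ x u, |x| ≤ K → |u| ≤ K →
      |f (x + u) - ∑ i ∈ Finset.range k, iteratedDeriv i f x * u ^ i / (i.factorial : ℝ)|
        ≤ C * |u| ^ k := by
  induction k with
  | zero =>
    intro f hf K
    obtain ⟨C, h0, hC⟩ := hf.exists_abs_le (K + K) 0
    refine ⟨C, h0, fun x u hx hu => ?_⟩
    simpa using hC (x + u) ((abs_add_le x u).trans (add_le_add hx hu))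
  | succ k ih =>
    intro f hf K
    obtain ⟨C, h0, hC⟩ := ih (contDiff_deriv hf) K
    refine ⟨C, h0, fun x u hx hu => ?_⟩
    set r : ℝ → ℝ := fun v =>
      f (x + v) - ∑ i ∈ Finset.range (k + 1), iteratedDeriv i f x * v ^ i / (i.factorial : ℝ)
    have hr0 : r 0 = 0 := by
      simp [r, Finset.sum_range_succ']
    have hd : ∀ v, HasDerivAt r (deriv f (x + v) - ∑ i ∈ Finset.range k,
        iteratedDeriv i (deriv f) x * v ^ i / (i.factorial : ℝ)) v := by
      intro v
      have h1 : HasDerivAt (fun v => f (x + v)) (deriv f (x + v)) v := by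
        have := ((hf.differentiable (by simp)) (x + v)).hasDerivAt
        simpa using this.comp_const_add x v
      have h2 : HasDerivAt (fun v : ℝ => ∑ i ∈ Finset.range (k + 1),
          iteratedDeriv i f x * v ^ i / (i.factorial : ℝ)) (∑ i ∈ Finset.range k,
        iteratedDeriv i (deriv f) x * v ^ i / (i.factorial : ℝ)) v := by
        simp_rw [Finset.sum_range_succ']
        have h3 := HasDerivAt.fun_sum (u := Finset.range k) (x := v)
          (A := fun i v => iteratedDeriv (i + 1) f x * v ^ (i + 1) / ((i + 1).factorial : ℝ))
          (A' := fun i => iteratedDeriv i (deriv f) x * v ^ i / (i.factorial : ℝ)) (by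
            intro i _
            have := (((hasDerivAt_pow (i + 1) v).const_mul
              (iteratedDeriv (i + 1) f x)).div_const ((i + 1).factorial : ℝ))
            refine this.congr_deriv ?_
            rw [iteratedDeriv_succ', Nat.factorial_succ]
            push_cast
            have : (i.factorial : ℝ) ≠ 0 := by positivity
            field_simp)
        simpa using h3.add_const (iteratedDeriv 0 f x * v ^ 0 / (Nat.factorial 0 : ℝ))
      exact h1.sub h2
    have hmv := (convex_uIcc (0 : ℝ) u).norm_image_sub_le_of_norm_hasDerivWithin_le
      (f := r) (C := C * |u| ^ k) (x := 0) (y := u)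
      (fun v _ => (hd v).hasDerivWithinAt) (by
        intro v hv
        have hvu : |v| ≤ |u| := by
          have := Set.abs_sub_left_of_mem_uIcc hv
          simpa using this
        refine (hC x v hx (hvu.trans hu)).trans ?_
        gcongr) Set.left_mem_uIcc Set.right_mem_uIcc
    rw [hr0, sub_zero, sub_zero, Real.norm_eq_abs, Real.norm_eq_abs] at hmv
    calc _ = |r u| := rfl
      _ ≤ _ := hmv
      _ = _ := by ring

lemma iteratedDeriv_three_of_deriv_eq_mul {f g Φ : ℝ → ℝ} (hf : ContDiff ℝ (⊤ : ℕ∞) f)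
    (hg : ContDiff ℝ (⊤ : ℕ∞) g) (hΦ : ∀ x, deriv Φ x = f x * deriv g x) (x : ℝ) :
    iteratedDeriv 3 Φ x = iteratedDeriv 2 f x * deriv g x + 2 * (deriv f x * iteratedDeriv 2 g x)
      + f x * iteratedDeriv 3 g x := by
  have h1 : deriv Φ = fun x => f x * deriv g x := funext hΦ
  have df : Differentiable ℝ f := hf.differentiable (by simp)
  have df1 : Differentiable ℝ (deriv f) := (contDiff_deriv hf).differentiable (by simp)
  have dg1 : Differentiable ℝ (deriv g) := (contDiff_deriv hg).differentiable (by simp)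
  have dg2 : Differentiable ℝ (deriv (deriv g)) :=
    (contDiff_deriv (contDiff_deriv hg)).differentiable (by simp)
  have h2 : deriv (fun x => f x * deriv g x)
      = fun x => deriv f x * deriv g x + f x * deriv (deriv g) x := by
    ext y
    exact deriv_fun_mul (df y) (dg1 y)
  have h3 : deriv (fun x => deriv f x * deriv g x + f x * deriv (deriv g) x) x
      = deriv (deriv f) x * deriv g x + deriv f x * deriv (deriv g) x
        + (deriv f x * deriv (deriv g) x + f x * deriv (deriv (deriv g)) x) := by
    rw [deriv_fun_add (by fun_prop) (by fun_prop), deriv_fun_mul (df1 x) (dg1 x),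
      deriv_fun_mul (df x) (dg2 x)]
  simp only [iteratedDeriv_succ', iteratedDeriv_zero, h1, h2, h3]
  ring

/-- Fifth order expansion of the trapezoidal increment around the midpoint. -/
lemma exists_trapezoid_expansion {f g Φ : ℝ → ℝ} (hf : ContDiff ℝ (⊤ : ℕ∞) f)
    (hg : ContDiff ℝ (⊤ : ℕ∞) g) (hΦ : ContDiff ℝ (⊤ : ℕ∞) Φ)
    (hΦ' : ∀ x, deriv Φ x = f x * deriv g x) :
    ∃ ψ : ℝ → ℝ, ContDiff ℝ (⊤ : ℕ∞) ψ ∧ ∀ K : ℝ, ∃ C, 0 ≤ C ∧ ∀ a b, |a| ≤ K → |b| ≤ K →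
      |(f a + f b) / 2 * (g b - g a) - (Φ b - Φ a)
        - 1 / 12 * ((iteratedDeriv 2 f ((a + b) / 2) * deriv g ((a + b) / 2)
          - deriv f ((a + b) / 2) * iteratedDeriv 2 g ((a + b) / 2)) * (b - a) ^ 3)
        - ψ ((a + b) / 2) * (b - a) ^ 5| ≤ C * |b - a| ^ 7 := by
  have hi : ∀ {f : ℝ → ℝ} (i : ℕ), ContDiff ℝ (⊤ : ℕ∞) f →
      ContDiff ℝ (⊤ : ℕ∞) (iteratedDeriv i f) := by
    intro f i hf
    induction i generalizing f with
    | zero => simpa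
    | succ i ih => rw [iteratedDeriv_succ']; exact ih (contDiff_deriv hf)
  refine ⟨fun x => (f x * iteratedDeriv 5 g x / 60 + iteratedDeriv 2 f x * iteratedDeriv 3 g x / 6
    + iteratedDeriv 4 f x * iteratedDeriv 1 g x / 12 - iteratedDeriv 5 Φ x / 60) / 32, ?_, ?_⟩
  · have := hi 5 hg
    have := hi 3 hg
    have := hi 1 hg
    have := hi 2 hf
    have := hi 4 hf
    have := hi 5 hΦ
    fun_prop
  intro K
  obtain ⟨F0, hF0, hF0'⟩ := hf.exists_abs_le K 0
  obtain ⟨F2, hF2, hF2'⟩ := hf.exists_abs_le K 2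
  obtain ⟨F4, hF4, hF4'⟩ := hf.exists_abs_le K 4
  obtain ⟨G3, hG3, hG3'⟩ := hg.exists_abs_le K 3
  obtain ⟨G5, hG5, hG5'⟩ := hg.exists_abs_le K 5
  obtain ⟨Cf, hCf, hCf'⟩ := exists_taylor_bound 6 hf K
  obtain ⟨Cg, hCg, hCg'⟩ := exists_taylor_bound 7 hg K
  obtain ⟨Cl, hCl, hCl'⟩ := exists_taylor_bound 1 hg K
  obtain ⟨Cp, hCp, hCp'⟩ := exists_taylor_bound 7 hΦ K
  refine ⟨F2 * G5 + F4 * G3 + K ^ 2 * (F4 * G5) + 2 * Cf * Cl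
    + (F0 + F2 * K ^ 2 + F4 * K ^ 4) * (2 * Cg) + 2 * Cp, by positivity, fun a b ha hb => ?_⟩
  obtain ⟨β, hβ⟩ : ∃ β, β = (a + b) / 2 := ⟨_, rfl⟩
  obtain ⟨u, hu⟩ : ∃ u, u = (b - a) / 2 := ⟨_, rfl⟩
  have hβK : |β| ≤ K := by
    rw [abs_le] at *; constructor <;> linarith [ha.1, ha.2, hb.1, hb.2]
  have huK : |u| ≤ K := by
    rw [abs_le] at *; constructor <;> linarith [ha.1, ha.2, hb.1, hb.2]
  have hnu : |-u| ≤ K := by rwa [abs_neg]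
  have ea : a = β + -u := by rw [hβ, hu]; ring
  have eb : b = β + u := by rw [hβ, hu]; ring
  have e1 : b - a = 2 * u := by rw [hu]; ring
  rw [← hβ, e1, ea, eb]
  have f1 := hCf' β u hβK huK
  have f2 := hCf' β (-u) hβK hnu
  have g1 := hCg' β u hβK huK
  have g2 := hCg' β (-u) hβK hnu
  have l1 := hCl' β u hβK huK
  have l2 := hCl' β (-u) hβK hnu
  have p1 := hCp' β u hβK huK
  have p2 := hCp' β (-u) hβK hnu
  have q3 := iteratedDeriv_three_of_deriv_eq_mul hf hg hΦ' β
  have q1 := hΦ' β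
  have F0'' := hF0' β hβK
  have F2'' := hF2' β hβK
  have F4'' := hF4' β hβK
  have G3'' := hG3' β hβK
  have G5'' := hG5' β hβK
  simp only [abs_neg, Finset.sum_range_succ, Finset.sum_range_zero, iteratedDeriv_zero,
    Nat.factorial, zero_add] at f1 f2 g1 g2 l1 l2 p1 p2 F0''
  norm_num at f1 f2 g1 g2 l1 l2 p1 p2
  rw [q1, q3] at p1 p2
  simp only [iteratedDeriv_one]
  generalize f (β + u) = fp at *
  generalize f (β + -u) = fm at *
  generalize g (β + u) = gp at *
  generalize g (β + -u) = gm at *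
  generalize Φ (β + u) = pp at *
  generalize Φ (β + -u) = pm at *
  generalize f β = a0 at *
  generalize iteratedDeriv 2 f β = a2 at *
  generalize iteratedDeriv 4 f β = a4 at *
  generalize iteratedDeriv 3 g β = b3 at *
  generalize iteratedDeriv 5 g β = b5 at *
  set r1 := fp - _
  set r2 := fm - _
  set s1 := gp - (_ + _)
  set s2 := gm - (_ + _)
  set t1 := pp - (_ + _)
  set t2 := pm - (_ + _)
  have B1 : |u ^ 7 * (a2 * b5 / 120 + a4 * b3 / 72)| ≤ |u| ^ 7 * (F2 * G5 + F4 * G3) := by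
    rw [abs_mul, abs_pow]
    have h1 : |a2 * b5| ≤ F2 * G5 := by rw [abs_mul]; gcongr
    have h2 : |a4 * b3| ≤ F4 * G3 := by rw [abs_mul]; gcongr
    gcongr
    rw [abs_le] at h1 h2 ⊢
    constructor <;> linarith [h1.1, h1.2, h2.1, h2.2]
  have B2 : |u ^ 7 * (u ^ 2 * (a4 * b5) / 1440)| ≤ |u| ^ 7 * (K ^ 2 * (F4 * G5)) := by
    rw [abs_mul, abs_pow]
    have h1 : |u ^ 2 * (a4 * b5)| ≤ K ^ 2 * (F4 * G5) := by
      rw [abs_mul, abs_mul, abs_pow]; gcongr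
    gcongr
    rw [abs_le] at h1 ⊢
    constructor <;> linarith [h1.1, h1.2]
  have B3 : |(r1 + r2) / 2 * ((gp - g β) - (gm - g β))| ≤ (Cf * |u| ^ 6) * (2 * (Cl * |u|)) := by
    rw [abs_mul]
    gcongr
    · rw [abs_le] at f1 f2 ⊢
      constructor <;> linarith [f1.1, f2.1, f1.2, f2.2]
    · refine (abs_sub _ _).trans ?_
      linarith
  have B4 : |(a0 + a2 * u ^ 2 / 2 + a4 * u ^ 4 / 24) * (s1 - s2)|
      ≤ (F0 + F2 * K ^ 2 + F4 * K ^ 4) * (2 * (Cg * |u| ^ 7)) := by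
    have h1 : |a2 * u ^ 2| ≤ F2 * K ^ 2 := by rw [abs_mul, abs_pow]; gcongr
    have h2 : |a4 * u ^ 4| ≤ F4 * K ^ 4 := by rw [abs_mul, abs_pow]; gcongr
    rw [abs_mul]
    gcongr
    · rw [abs_le] at h1 h2 F0'' ⊢
      constructor <;> linarith [h1.1, h1.2, h2.1, h2.2, F0''.1, F0''.2]
    · refine (abs_sub _ _).trans ?_
      linarith
  have B5 : |t1 - t2| ≤ 2 * (Cp * |u| ^ 7) := by
    refine (abs_sub _ _).trans ?_
    linarith
  have key : ∀ x1 x2 x3 x4 x5 : ℝ, |x1 + x2 + x3 + x4 - x5| ≤ |x1| + |x2| + |x3| + |x4| + |x5| := by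
    intro x1 x2 x3 x4 x5
    refine (abs_sub _ _).trans (add_le_add_left ((abs_add_le _ _).trans
      (add_le_add_left ((abs_add_le _ _).trans (add_le_add_left (abs_add_le _ _) _)) _)) _)
  have hu7 : |2 * u| ^ 7 = 128 * |u| ^ 7 := by rw [abs_mul, mul_pow]; norm_num
  have hid := key (u ^ 7 * (a2 * b5 / 120 + a4 * b3 / 72)) (u ^ 7 * (u ^ 2 * (a4 * b5) / 1440))
    ((r1 + r2) / 2 * ((gp - g β) - (gm - g β)))
    ((a0 + a2 * u ^ 2 / 2 + a4 * u ^ 4 / 24) * (s1 - s2)) (t1 - t2)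
  rw [hu7]
  have hC : 0 ≤ F2 * G5 + F4 * G3 + K ^ 2 * (F4 * G5) + 2 * Cf * Cl
    + (F0 + F2 * K ^ 2 + F4 * K ^ 4) * (2 * Cg) + 2 * Cp := by positivity
  have h7 : 0 ≤ |u| ^ 7 := by positivity
  have hfin : |u| ^ 7 * (F2 * G5 + F4 * G3) + |u| ^ 7 * (K ^ 2 * (F4 * G5))
      + (Cf * |u| ^ 6) * (2 * (Cl * |u|)) + (F0 + F2 * K ^ 2 + F4 * K ^ 4) * (2 * (Cg * |u| ^ 7))
      + 2 * (Cp * |u| ^ 7) ≤ (F2 * G5 + F4 * G3 + K ^ 2 * (F4 * G5) + 2 * Cf * Cl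
    + (F0 + F2 * K ^ 2 + F4 * K ^ 4) * (2 * Cg) + 2 * Cp) * (128 * |u| ^ 7) := by
    linarith [mul_nonneg hC h7]
  refine le_trans (le_of_eq ?_) ((hid.trans (by linarith)).trans hfin)
  congr 1
  simp only [r1, r2, s1, s2, t1, t2]
  ring

/-- Increment of a sequence. -/
def seqInc (x : ℕ → ℝ) (j : ℕ) : ℝ := x (j + 1) - x j

/-- Midpoint of `x (q + i)` and `x (q + i + 1)`, relative to `x q`. -/
def seqMid (x : ℕ → ℝ) (q i : ℕ) : ℝ := (x (q + i) + x (q + i + 1)) / 2 - x q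

/-- Contribution of the block of length `m` starting at `q` to `seqMajorant`. -/
def blockMajorant (x : ℕ → ℝ) (m : ℕ) (s μ : ℝ) (q : ℕ) : ℝ :=
  2 * μ + (∑ i ∈ Finset.range m, seqInc x (q + i) ^ 5) ^ 2 / μ
    + (∑ i ∈ Finset.range m, seqMid x q i * seqInc x (q + i) ^ 5) ^ 2 / μ
    + ∑ i ∈ Finset.range m,
        seqMid x q i ^ 2 * (s * seqInc x (q + i) ^ 4 + seqInc x (q + i) ^ 6 / s)

/-- A polynomial majorant of the error of the change-of-variable formula along the sequence `x`,
obtained by splitting `M` steps into blocks of length `m`. -/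
def seqMajorant (x : ℕ → ℝ) (m M : ℕ) (s μ l : ℝ) : ℝ :=
  ∑ j ∈ Finset.range M, (s * seqInc x j ^ 6 + seqInc x j ^ 8 / s)
    + ∑ p ∈ Finset.range (M / m), blockMajorant x m s μ (p * m)
    + (m * l + ∑ j ∈ Finset.range M, seqInc x j ^ 10 / l)

lemma le_add_sq_div (y : ℝ) {s : ℝ} (hs : 0 < s) : y ≤ s + y ^ 2 / s := by
  rcases le_total y s with h1 | h1
  · have : 0 ≤ y ^ 2 / s := by positivity
    linarith
  · have : y ≤ y ^ 2 / s := by rw [le_div_iff₀ hs]; nlinarith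
    linarith

lemma sum_range_mul_add (F : ℕ → ℝ) (m P : ℕ) : ∑ j ∈ Finset.range (P * m), F j
    = ∑ p ∈ Finset.range P, ∑ i ∈ Finset.range m, F (p * m + i) := by
  induction P with
  | zero => simp
  | succ P ih => rw [Finset.sum_range_succ, ← ih, Nat.succ_mul, Finset.sum_range_add]

lemma blockMajorant_nonneg (x : ℕ → ℝ) (m : ℕ) {s μ : ℝ} (hs : 0 < s) (hμ : 0 < μ) (q : ℕ) :
    0 ≤ blockMajorant x m s μ q := by
  have h : ∀ i, 0 ≤ seqInc x (q + i) ^ 4 := fun i => by positivity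
  have h' : ∀ i, 0 ≤ seqInc x (q + i) ^ 6 := fun i => by positivity
  unfold blockMajorant
  have : 0 ≤ ∑ i ∈ Finset.range m,
        seqMid x q i ^ 2 * (s * seqInc x (q + i) ^ 4 + seqInc x (q + i) ^ 6 / s) :=
    Finset.sum_nonneg fun i _ => by have := h i; have := h' i; positivity
  positivity

lemma abs_pow_five_le (y : ℝ) {s : ℝ} (hs : 0 < s) : |y| ^ 5 ≤ s * y ^ 4 + y ^ 6 / s := by
  have h4 : |y| ^ 4 = y ^ 4 := by rw [← abs_pow, abs_of_nonneg (by positivity)]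
  have h := mul_le_mul_of_nonneg_left (le_add_sq_div |y| hs) (show 0 ≤ y ^ 4 by positivity)
  rw [sq_abs] at h
  calc |y| ^ 5 = y ^ 4 * |y| := by rw [← h4]; ring
    _ ≤ _ := h
    _ = _ := by ring

/-- Weighted sums of fifth powers of increments over one block. -/
lemma exists_block_bound {ψ : ℝ → ℝ} (hψ : ContDiff ℝ (⊤ : ℕ∞) ψ) (K : ℝ) :
    ∃ C, 0 ≤ C ∧ ∀ (x : ℕ → ℝ) (m q : ℕ) (s μ : ℝ), 0 < s → 0 < μ →
      (∀ j ≤ q + m, |x j| ≤ K) →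
      |∑ i ∈ Finset.range m, ψ ((x (q + i) + x (q + i + 1)) / 2) * seqInc x (q + i) ^ 5|
        ≤ C * blockMajorant x m s μ q := by
  obtain ⟨C0, h0, hC0⟩ := hψ.exists_abs_le K 0
  obtain ⟨C1, h1, hC1⟩ := hψ.exists_abs_le K 1
  obtain ⟨C2, h2, hC2⟩ := exists_taylor_bound 2 hψ (2 * K)
  refine ⟨C0 + C1 + C2, by positivity, fun x m q s μ hs hμ hx => ?_⟩
  have hq := hx q (by omega)
  have hK : 0 ≤ K := (abs_nonneg _).trans hq
  have hterm : ∀ i ∈ Finset.range m,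
      |ψ ((x (q + i) + x (q + i + 1)) / 2) * seqInc x (q + i) ^ 5
        - (ψ (x q) * seqInc x (q + i) ^ 5
          + deriv ψ (x q) * (seqMid x q i * seqInc x (q + i) ^ 5))|
      ≤ C2 * (seqMid x q i ^ 2 * (s * seqInc x (q + i) ^ 4 + seqInc x (q + i) ^ 6 / s)) := by
    intro i hi
    rw [Finset.mem_range] at hi
    have ha := hx (q + i) (by omega)
    have hb := hx (q + i + 1) (by omega)
    have hT := hC2 (x q) (seqMid x q i) (by linarith) (by
      unfold seqMid
      rw [abs_le] at *
      constructor <;> linarith [ha.1, ha.2, hb.1, hb.2, hq.1, hq.2])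
    have e : x q + seqMid x q i = (x (q + i) + x (q + i + 1)) / 2 := by unfold seqMid; ring
    simp only [e, Finset.sum_range_succ, Finset.sum_range_zero, iteratedDeriv_zero, Nat.factorial,
      iteratedDeriv_one] at hT
    norm_num at hT
    have e2 : ψ ((x (q + i) + x (q + i + 1)) / 2) * seqInc x (q + i) ^ 5
        - (ψ (x q) * seqInc x (q + i) ^ 5
          + deriv ψ (x q) * (seqMid x q i * seqInc x (q + i) ^ 5))
        = (ψ ((x (q + i) + x (q + i + 1)) / 2) - (ψ (x q) + deriv ψ (x q) * seqMid x q i))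
          * seqInc x (q + i) ^ 5 := by ring
    rw [e2, abs_mul, abs_pow, ← mul_assoc]
    exact mul_le_mul hT (abs_pow_five_le _ hs) (by positivity) (by positivity)
  have hsum := (Finset.abs_sum_le_sum_abs _ _).trans (Finset.sum_le_sum hterm)
  rw [Finset.sum_sub_distrib, Finset.sum_add_distrib, ← Finset.mul_sum, ← Finset.mul_sum,
    ← Finset.mul_sum] at hsum
  have hA := hC0 (x q) hq
  have hB := hC1 (x q) hq
  rw [iteratedDeriv_zero] at hA
  rw [iteratedDeriv_one] at hB
  have hnn : ∀ i ∈ Finset.range m, 0 ≤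
        seqMid x q i ^ 2 * (s * seqInc x (q + i) ^ 4 + seqInc x (q + i) ^ 6 / s) := fun i _ => by
    have : 0 ≤ seqInc x (q + i) ^ 4 := by positivity
    have : 0 ≤ seqInc x (q + i) ^ 6 := by positivity
    positivity
  have hnn := Finset.sum_nonneg hnn
  unfold blockMajorant
  generalize (∑ i ∈ Finset.range m, ψ ((x (q + i) + x (q + i + 1)) / 2) * seqInc x (q + i) ^ 5)
    = S at *
  generalize (∑ i ∈ Finset.range m, seqInc x (q + i) ^ 5) = S1 at *
  generalize (∑ i ∈ Finset.range m, seqMid x q i * seqInc x (q + i) ^ 5) = S2 at *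
  generalize (∑ i ∈ Finset.range m,
        seqMid x q i ^ 2 * (s * seqInc x (q + i) ^ 4 + seqInc x (q + i) ^ 6 / s)) = Q at *
  have k1 : |ψ (x q) * S1| ≤ C0 * (μ + S1 ^ 2 / μ) := by
    rw [abs_mul]
    have := le_add_sq_div |S1| hμ
    rw [sq_abs] at this
    exact mul_le_mul hA this (abs_nonneg _) h0
  have k2 : |deriv ψ (x q) * S2| ≤ C1 * (μ + S2 ^ 2 / μ) := by
    rw [abs_mul]
    have := le_add_sq_div |S2| hμ
    rw [sq_abs] at this
    exact mul_le_mul hB this (abs_nonneg _) h1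
  have p1 : 0 ≤ S1 ^ 2 / μ := by positivity
  have p2 : 0 ≤ S2 ^ 2 / μ := by positivity
  have : |S| ≤ |S - (ψ (x q) * S1 + deriv ψ (x q) * S2)| + |ψ (x q) * S1|
      + |deriv ψ (x q) * S2| := by
    have := abs_add_three (S - (ψ (x q) * S1 + deriv ψ (x q) * S2)) (ψ (x q) * S1)
      (deriv ψ (x q) * S2)
    rwa [show S - (ψ (x q) * S1 + deriv ψ (x q) * S2) + ψ (x q) * S1 + deriv ψ (x q) * S2 = S by
      ring] at this
  have q0 : 0 ≤ C0 * (μ + S2 ^ 2 / μ + Q) := by positivity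
  have q1 : 0 ≤ C1 * (μ + S1 ^ 2 / μ + Q) := by positivity
  have q2 : 0 ≤ C2 * (2 * μ + S1 ^ 2 / μ + S2 ^ 2 / μ) := by positivity
  linarith

lemma exists_weighted_sum_bound {ψ : ℝ → ℝ} (hψ : ContDiff ℝ (⊤ : ℕ∞) ψ) (K : ℝ) :
    ∃ C, 0 ≤ C ∧ ∀ (x : ℕ → ℝ) (m M N : ℕ) (s μ l : ℝ), 0 < m → 0 < s → 0 < μ → 0 < l →
      N ≤ M → (∀ j ≤ M, |x j| ≤ K) →
      |∑ j ∈ Finset.range N, ψ ((x j + x (j + 1)) / 2) * seqInc x j ^ 5|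
        ≤ C * (∑ p ∈ Finset.range (M / m), blockMajorant x m s μ (p * m)
          + (m * l + ∑ j ∈ Finset.range M, seqInc x j ^ 10 / l)) := by
  obtain ⟨C, hC0, hC⟩ := exists_block_bound hψ K
  obtain ⟨D, hD0, hD⟩ := hψ.exists_abs_le K 0
  refine ⟨C + D, by positivity, fun x m M N s μ l hm hs hμ hl hN hx => ?_⟩
  have hNm : N / m * m + N % m = N := Nat.div_add_mod' N m
  have hr : N % m < m := Nat.mod_lt _ hm
  have hsplit : ∑ j ∈ Finset.range N, ψ ((x j + x (j + 1)) / 2) * seqInc x j ^ 5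
      = ∑ p ∈ Finset.range (N / m), ∑ i ∈ Finset.range m,
          ψ ((x (p * m + i) + x (p * m + i + 1)) / 2) * seqInc x (p * m + i) ^ 5
        + ∑ i ∈ Finset.range (N % m),
          ψ ((x (N / m * m + i) + x (N / m * m + i + 1)) / 2) * seqInc x (N / m * m + i) ^ 5 := by
    conv_lhs => rw [← hNm]
    rw [Finset.sum_range_add, sum_range_mul_add]
  have hfull : |∑ p ∈ Finset.range (N / m), ∑ i ∈ Finset.range m,
          ψ ((x (p * m + i) + x (p * m + i + 1)) / 2) * seqInc x (p * m + i) ^ 5|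
      ≤ C * ∑ p ∈ Finset.range (M / m), blockMajorant x m s μ (p * m) := by
    refine (Finset.abs_sum_le_sum_abs _ _).trans ?_
    rw [Finset.mul_sum]
    refine (Finset.sum_le_sum (fun p hp => ?_)).trans
      (Finset.sum_le_sum_of_subset_of_nonneg
        (Finset.range_subset_range.mpr (Nat.div_le_div_right hN)) fun p _ _ =>
          mul_nonneg hC0 (blockMajorant_nonneg x m hs hμ (p * m)))
    refine hC x m (p * m) s μ hs hμ fun j hj => hx j ?_
    rw [Finset.mem_range] at hp
    have : (p + 1) * m ≤ N / m * m := Nat.mul_le_mul_right m hp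
    rw [Nat.succ_mul] at this
    omega
  have h10 : ∀ j, 0 ≤ seqInc x j ^ 10 / l := fun j => by positivity
  have hpart : |∑ i ∈ Finset.range (N % m),
          ψ ((x (N / m * m + i) + x (N / m * m + i + 1)) / 2) * seqInc x (N / m * m + i) ^ 5|
      ≤ D * (m * l + ∑ j ∈ Finset.range M, seqInc x j ^ 10 / l) := by
    calc _ ≤ ∑ i ∈ Finset.range (N % m), D * (l + seqInc x (N / m * m + i) ^ 10 / l) := by
          refine (Finset.abs_sum_le_sum_abs _ _).trans (Finset.sum_le_sum fun i hi => ?_)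
          rw [Finset.mem_range] at hi
          have ha := hx (N / m * m + i) (by omega)
          have hb := hx (N / m * m + i + 1) (by omega)
          have h1 := hD ((x (N / m * m + i) + x (N / m * m + i + 1)) / 2) (by
            rw [abs_le] at *
            constructor <;> linarith [ha.1, ha.2, hb.1, hb.2])
          rw [iteratedDeriv_zero] at h1
          have h2 := le_add_sq_div |seqInc x (N / m * m + i) ^ 5| hl
          rw [sq_abs, ← pow_mul] at h2
          rw [abs_mul]
          exact mul_le_mul h1 h2 (abs_nonneg _) hD0
      _ = D * ((N % m : ℕ) * l + ∑ i ∈ Finset.range (N % m), seqInc x (N / m * m + i) ^ 10 / l) := by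
          rw [← Finset.mul_sum, Finset.sum_add_distrib]; simp
      _ ≤ _ := by
          have e1 : ((N % m : ℕ) : ℝ) ≤ m := by exact_mod_cast hr.le
          have e2 : ∑ i ∈ Finset.range (N % m), seqInc x (N / m * m + i) ^ 10 / l
              ≤ ∑ j ∈ Finset.range M, seqInc x j ^ 10 / l := by
            have e3 := Finset.sum_range_add (fun j => seqInc x j ^ 10 / l) (N / m * m) (N % m)
            rw [hNm] at e3
            have e4 : 0 ≤ ∑ j ∈ Finset.range (N / m * m), seqInc x j ^ 10 / l :=
              Finset.sum_nonneg fun j _ => h10 j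
            have e5 := Finset.sum_le_sum_of_subset_of_nonneg
              (Finset.range_subset_range.mpr hN) (fun j _ _ => h10 j)
            linarith
          gcongr
  have n1 : 0 ≤ ∑ p ∈ Finset.range (M / m), blockMajorant x m s μ (p * m) :=
    Finset.sum_nonneg fun p _ => blockMajorant_nonneg x m hs hμ _
  have n2 : 0 ≤ m * l + ∑ j ∈ Finset.range M, seqInc x j ^ 10 / l :=
    add_nonneg (by positivity) (Finset.sum_nonneg fun j _ => h10 j)
  rw [hsplit]
  refine (abs_add_le _ _).trans ((add_le_add hfull hpart).trans ?_)
  nlinarith [mul_nonneg hC0 n2, mul_nonneg hD0 n1]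

/-- Pathwise bound for the error of the change-of-variable formula along a bounded sequence. -/
lemma exists_error_bound {f g Φ : ℝ → ℝ} (hf : ContDiff ℝ (⊤ : ℕ∞) f)
    (hg : ContDiff ℝ (⊤ : ℕ∞) g) (hΦ : ContDiff ℝ (⊤ : ℕ∞) Φ)
    (hΦ' : ∀ x, deriv Φ x = f x * deriv g x) (K : ℝ) :
    ∃ C, 0 ≤ C ∧ ∀ (x : ℕ → ℝ) (m M N : ℕ) (s μ l : ℝ), 0 < m → 0 < s → 0 < μ → 0 < l →
      N ≤ M → (∀ j ≤ M, |x j| ≤ K) →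
      |(∑ j ∈ Finset.range N, (f (x j) + f (x (j + 1))) / 2 * (g (x (j + 1)) - g (x j)))
        - Φ (x N) + Φ (x 0)
        - 1 / 12 * ∑ j ∈ Finset.range N,
          (iteratedDeriv 2 f ((x j + x (j + 1)) / 2) * deriv g ((x j + x (j + 1)) / 2)
            - deriv f ((x j + x (j + 1)) / 2) * iteratedDeriv 2 g ((x j + x (j + 1)) / 2))
            * (x (j + 1) - x j) ^ 3|
        ≤ C * seqMajorant x m M s μ l := by
  obtain ⟨ψ, hψ, hexp⟩ := exists_trapezoid_expansion hf hg hΦ hΦ'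
  obtain ⟨C, hC0, hC⟩ := hexp K
  obtain ⟨D, hD0, hD⟩ := exists_weighted_sum_bound hψ K
  refine ⟨C + D, by positivity, fun x m M N s μ l hm hs hμ hl hN hx => ?_⟩
  have hw := hD x m M N s μ l hm hs hμ hl hN hx
  have htel : ∑ j ∈ Finset.range N, (Φ (x (j + 1)) - Φ (x j)) = Φ (x N) - Φ (x 0) :=
    Finset.sum_range_sub (fun j => Φ (x j)) N
  have hpos : ∀ j, 0 ≤ s * seqInc x j ^ 6 + seqInc x j ^ 8 / s := fun j => by
    have : 0 ≤ seqInc x j ^ 6 := by positivity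
    have : 0 ≤ seqInc x j ^ 8 := by positivity
    positivity
  have hrem : |∑ j ∈ Finset.range N, ((f (x j) + f (x (j + 1))) / 2 * (g (x (j + 1)) - g (x j))
      - (Φ (x (j + 1)) - Φ (x j))
      - 1 / 12 * ((iteratedDeriv 2 f ((x j + x (j + 1)) / 2) * deriv g ((x j + x (j + 1)) / 2)
            - deriv f ((x j + x (j + 1)) / 2) * iteratedDeriv 2 g ((x j + x (j + 1)) / 2))
            * (x (j + 1) - x j) ^ 3) - ψ ((x j + x (j + 1)) / 2) * seqInc x j ^ 5)|
      ≤ C * ∑ j ∈ Finset.range M, (s * seqInc x j ^ 6 + seqInc x j ^ 8 / s) := by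
    refine (Finset.abs_sum_le_sum_abs _ _).trans ?_
    rw [Finset.mul_sum]
    refine (Finset.sum_le_sum (fun j hj => ?_)).trans
      (Finset.sum_le_sum_of_subset_of_nonneg (Finset.range_subset_range.mpr hN) fun p _ _ =>
          mul_nonneg hC0 (hpos p))
    rw [Finset.mem_range] at hj
    refine (hC (x j) (x (j + 1)) (hx j (by omega)) (hx (j + 1) (by omega))).trans ?_
    refine mul_le_mul_of_nonneg_left ?_ hC0
    have h6 := mul_le_mul_of_nonneg_right (abs_pow_five_le (seqInc x j) hs)
      (show 0 ≤ seqInc x j ^ 2 by positivity)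
    calc |x (j + 1) - x j| ^ 7 = |seqInc x j| ^ 5 * seqInc x j ^ 2 := by
          rw [← sq_abs (seqInc x j)]; unfold seqInc; ring
      _ ≤ _ := h6
      _ = _ := by ring
  rw [Finset.sum_sub_distrib, Finset.sum_sub_distrib, Finset.sum_sub_distrib, htel,
    ← Finset.mul_sum] at hrem
  have n1 : 0 ≤ ∑ p ∈ Finset.range (M / m), blockMajorant x m s μ (p * m) :=
    Finset.sum_nonneg fun p _ => blockMajorant_nonneg x m hs hμ _
  have n2 : 0 ≤ m * l + ∑ j ∈ Finset.range M, seqInc x j ^ 10 / l :=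
    add_nonneg (by positivity) (Finset.sum_nonneg fun j _ => by positivity)
  have n3 := Finset.sum_nonneg fun j (_ : j ∈ Finset.range M) => hpos j
  unfold seqMajorant
  refine le_trans (le_trans (le_of_eq ?_) (abs_add_le _ _)) ((add_le_add hrem hw).trans ?_)
  · congr 1; ring
  · nlinarith [mul_nonneg hC0 n2, mul_nonneg hD0 n3, mul_nonneg hC0 n1]

/-- All moments of `X` are finite. -/
def HasMoments {Ω : Type*} [MeasurableSpace Ω] (X : Ω → ℝ) (P : Measure Ω) : Prop :=
  ∀ p : ENNReal, p ≠ ⊤ → MemLp X p P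

namespace HasMoments

variable {Ω : Type*} [MeasurableSpace Ω] {P : Measure Ω} {X Y : Ω → ℝ}

lemma integrable (hX : HasMoments X P) : Integrable X P :=
  memLp_one_iff_integrable.mp (hX 1 ENNReal.one_ne_top)

lemma add (hX : HasMoments X P) (hY : HasMoments Y P) : HasMoments (fun ω => X ω + Y ω) P :=
  fun p hp => (hX p hp).add (hY p hp)

lemma sub (hX : HasMoments X P) (hY : HasMoments Y P) : HasMoments (fun ω => X ω - Y ω) P :=
  fun p hp => (hX p hp).sub (hY p hp)

lemma mul (hX : HasMoments X P) (hY : HasMoments Y P) : HasMoments (fun ω => X ω * Y ω) P := by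
  intro p hp
  have h2 : (2 * p) ≠ ⊤ := ENNReal.mul_ne_top ENNReal.ofNat_ne_top hp
  have : ENNReal.HolderTriple (2 * p) (2 * p) p := by
    constructor
    rw [ENNReal.mul_inv (by simp) (by simp), ← add_mul, ENNReal.inv_two_add_inv_two, one_mul]
  exact MemLp.mul' (r := p) (hY (2 * p) h2) (hX (2 * p) h2)

lemma const_mul (hX : HasMoments X P) (c : ℝ) : HasMoments (fun ω => c * X ω) P :=
  fun p hp => (hX p hp).const_mul c

lemma div_const (hX : HasMoments X P) (c : ℝ) : HasMoments (fun ω => X ω / c) P := by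
  simpa only [div_eq_inv_mul] using hX.const_mul c⁻¹

lemma const [IsFiniteMeasure P] (c : ℝ) : HasMoments (fun _ : Ω => c) P :=
  fun _ _ => memLp_const c

lemma pow [IsFiniteMeasure P] (hX : HasMoments X P) (k : ℕ) :
    HasMoments (fun ω => X ω ^ k) P := by
  induction k with
  | zero => simpa using const 1
  | succ k ih => simpa only [pow_succ] using ih.mul hX

lemma sum {ι : Type*} (s : Finset ι) {F : ι → Ω → ℝ}
    (hF : ∀ i ∈ s, HasMoments (F i) P) : HasMoments (fun ω => ∑ i ∈ s, F i ω) P :=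
  fun p hp => memLp_finsetSum s fun i hi => hF i hi p hp

end HasMoments

lemma hasMoments_of_map_eq_gaussianReal {Ω : Type*} [MeasurableSpace Ω] {P : Measure Ω}
    {X : Ω → ℝ} (hX : Measurable X) {v : NNReal} (h : P.map X = gaussianReal 0 v) :
    HasMoments X P := by
  intro p hp
  have := memLp_id_gaussianReal' (μ := 0) (v := v) p hp
  rw [← h, memLp_map_measure_iff aestronglyMeasurable_id hX.aemeasurable] at this
  simpa using this

lemma hasMoments_polynomial_gaussianReal (p : Polynomial ℝ) (v : NNReal) :
    HasMoments (fun x => p.eval x) (gaussianReal 0 v) := by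
  have h : HasMoments (fun x : ℝ => x) (gaussianReal 0 v) :=
    fun p hp => memLp_id_gaussianReal' p hp
  simp only [Polynomial.eval_eq_sum_range]
  exact HasMoments.sum _ fun i _ => (h.pow i).const_mul _

/-- Gaussian integration by parts for polynomials. -/
lemma integral_mul_eval_gaussianReal (p : Polynomial ℝ) (v : NNReal) :
    ∫ x, x * p.eval x ∂(gaussianReal 0 v) = v * ∫ x, p.derivative.eval x ∂(gaussianReal 0 v) := by
  rcases eq_or_ne v 0 with rfl | hv
  · simp
  have hint : ∀ q : Polynomial ℝ, Integrable (fun x => q.eval x * gaussianPDFReal 0 v x) := by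
    intro q
    have := (hasMoments_polynomial_gaussianReal q v).integrable
    rw [gaussianReal_of_var_ne_zero 0 hv, integrable_withDensity_iff (measurable_gaussianPDF 0 v)
      (ae_of_all _ fun x => gaussianPDF_lt_top)] at this
    simpa only [toReal_gaussianPDF] using this
  have hv' : (v : ℝ) ≠ 0 := by exact_mod_cast hv
  have hpdf : ∀ x, HasDerivAt (gaussianPDFReal 0 v)
      (-(x / v) * gaussianPDFReal 0 v x) x := by
    intro x
    rw [gaussianPDFReal_def]
    have h1 : HasDerivAt (fun x : ℝ => -(x - 0) ^ 2 / (2 * v)) (-(2 * x) / (2 * v)) x := by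
      have := (((hasDerivAt_id x).sub_const 0).pow 2).neg.div_const (2 * (v : ℝ))
      simpa using this
    convert! h1.exp.const_mul (√(2 * Real.pi * v))⁻¹ using 1
    field_simp
  have key := integral_mul_deriv_eq_deriv_mul_of_integrable
    (u := fun x => p.eval x) (u' := fun x => p.derivative.eval x)
    (v := gaussianPDFReal 0 v) (v' := fun x => -(x / v) * gaussianPDFReal 0 v x)
    (fun x _ => p.hasDerivAt x) (fun x _ => hpdf x) ?_ (hint _) (hint _)
  · rw [integral_gaussianReal_eq_integral_smul hv, integral_gaussianReal_eq_integral_smul hv]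
    simp only [smul_eq_mul]
    have e1 : ∀ x, gaussianPDFReal 0 v x * Polynomial.eval x p.derivative
        = Polynomial.eval x p.derivative * gaussianPDFReal 0 v x := fun x => mul_comm _ _
    simp only [e1]
    rw [← neg_eq_iff_eq_neg.mpr key, ← integral_neg, ← integral_const_mul]
    congr 1 with x
    field_simp
  · have := (hint (Polynomial.C (-(v : ℝ)⁻¹) * Polynomial.X * p))
    refine this.congr (ae_of_all _ fun x => ?_)
    simp
    ring

/-- `H` is a linear space of centered Gaussian random variables. -/
def IsGaussianSpace {Ω : Type*} [MeasurableSpace Ω] (H : Submodule ℝ (Ω → ℝ))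
    (P : Measure Ω) : Prop :=
  ∀ X ∈ H, Measurable X ∧ ∃ v : NNReal, P.map X = gaussianReal 0 v

namespace IsGaussianSpace

variable {Ω : Type*} [MeasurableSpace Ω] {P : Measure Ω} {H : Submodule ℝ (Ω → ℝ)}

lemma hasMoments (hH : IsGaussianSpace H P) {X : Ω → ℝ} (hX : X ∈ H) : HasMoments X P :=
  let ⟨hm, _, hv⟩ := hH X hX
  hasMoments_of_map_eq_gaussianReal hm hv

lemma integral_eq_zero (hH : IsGaussianSpace H P) {X : Ω → ℝ} (hX : X ∈ H) :
    ∫ ω, X ω ∂P = 0 := by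
  obtain ⟨hm, v, hv⟩ := hH X hX
  have := integral_map (μ := P) hm.aemeasurable (f := fun x : ℝ => x) aestronglyMeasurable_id
  rw [← this, hv, integral_id_gaussianReal]

lemma map_eq (hH : IsGaussianSpace H P) {X : Ω → ℝ} (hX : X ∈ H) :
    ∃ v : NNReal, P.map X = gaussianReal 0 v ∧ (v : ℝ) = ∫ ω, X ω ^ 2 ∂P := by
  obtain ⟨hm, v, hv⟩ := hH X hX
  refine ⟨v, hv, ?_⟩
  have h := variance_id_gaussianReal (μ := 0) (v := v)
  rw [← h, variance_of_integral_eq_zero aemeasurable_id (by simp),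
    ← hv, integral_map hm.aemeasurable (by fun_prop)]
  rfl

lemma hasGaussianLaw {E : Type*} [NormedAddCommGroup E] [NormedSpace ℝ E] [MeasurableSpace E]
    [BorelSpace E] (hH : IsGaussianSpace H P) {Y : Ω → E} (hY : Measurable Y)
    (h : ∀ L : E →L[ℝ] ℝ, (fun ω => L (Y ω)) ∈ H) : HasGaussianLaw Y P := by
  refine ⟨isGaussian_of_map_eq_gaussianReal fun L => ?_⟩
  obtain ⟨-, v, hv⟩ := hH _ (h L)
  refine ⟨0, v, ?_⟩
  rw [Measure.map_map (by fun_prop) hY]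
  exact hv

variable [IsProbabilityMeasure P]

lemma indepFun (hH : IsGaussianSpace H P) {X : Ω → ℝ} (hX : X ∈ H) {n : ℕ} {Y : Fin n → Ω → ℝ}
    (hY : ∀ i, Y i ∈ H) (hXY : ∀ i, ∫ ω, X ω * Y i ω ∂P = 0) :
    IndepFun X (fun ω i => Y i ω) P := by
  have hmX := (hH X hX).1
  have hmY : ∀ i, Measurable (Y i) := fun i => (hH _ (hY i)).1
  have hg : HasGaussianLaw (fun ω => ((fun _ : Fin 1 => X ω), fun i => Y i ω)) P := by
    refine hH.hasGaussianLaw (by fun_prop) fun L => ?_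
    have hL : (fun ω => L ((fun _ : Fin 1 => X ω), fun i => Y i ω))
        = L (fun _ => 1, 0) • X + ∑ i, L (0, Pi.single i 1) • Y i := by
      ext ω
      have e : ((fun _ : Fin 1 => X ω), fun i => Y i ω)
          = X ω • ((fun _ => 1 : Fin 1 → ℝ), (0 : Fin n → ℝ))
            + ∑ i, Y i ω • ((0 : Fin 1 → ℝ), (Pi.single i 1 : Fin n → ℝ)) := by
        refine Prod.ext ?_ ?_
        · ext j
          simp [Prod.fst_sum]
        · ext j
          simp [Prod.snd_sum, Finset.sum_apply, Pi.single_apply]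
      simp only [e, map_add, map_sum, map_smul, smul_eq_mul, Pi.add_apply, Finset.sum_apply,
        Pi.smul_apply, mul_comm]
    rw [hL]
    exact H.add_mem (H.smul_mem _ hX) (H.sum_mem fun i _ => H.smul_mem _ (hY i))
  have hi := hg.indepFun_of_covariance_eval fun _ j => by
    rw [covariance_eq_sub (hH.hasMoments hX 2 (by simp)) (hH.hasMoments (hY j) 2 (by simp)),
      hH.integral_eq_zero hX, zero_mul, sub_zero]
    exact hXY j
  exact hi.comp (φ := fun x : Fin 1 → ℝ => x 0) (ψ := id) (by fun_prop) measurable_id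

/-- Wick's formula (Gaussian integration by parts) for three factors. -/
lemma integral_mul_pow_mul_pow_mul_pow (hH : IsGaussianSpace H P) {X U V W : Ω → ℝ}
    (hX : X ∈ H) (hU : U ∈ H) (hV : V ∈ H) (hW : W ∈ H) (p q r : ℕ) :
    ∫ ω, X ω * (U ω ^ p * V ω ^ q * W ω ^ r) ∂P
      = p * (∫ ω, X ω * U ω ∂P) * (∫ ω, U ω ^ (p - 1) * V ω ^ q * W ω ^ r ∂P)
        + q * (∫ ω, X ω * V ω ∂P) * (∫ ω, U ω ^ p * V ω ^ (q - 1) * W ω ^ r ∂P)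
        + r * (∫ ω, X ω * W ω ∂P) * (∫ ω, U ω ^ p * V ω ^ q * W ω ^ (r - 1) ∂P) := by
  have mX := hH.hasMoments hX
  have mU := hH.hasMoments hU
  have mV := hH.hasMoments hV
  have mW := hH.hasMoments hW
  obtain ⟨v, hv, hv2⟩ := hH.map_eq hX
  rcases eq_or_ne v 0 with rfl | hv0
  · have h0 : X =ᵐ[P] 0 := by
      have := (integral_eq_zero_iff_of_nonneg (fun ω => sq_nonneg (X ω)) (mX.pow 2).integrable).mp
        (by simpa using hv2.symm)
      filter_upwards [this] with ω hω
      simpa using hω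
    have hz : ∀ F : Ω → ℝ, ∫ ω, X ω * F ω ∂P = 0 := fun F => by
      rw [integral_congr_ae (g := 0)]
      · simp
      · filter_upwards [h0] with ω hω
        simp [hω]
    simp [hz]
  have hvr : (v : ℝ) ≠ 0 := by exact_mod_cast hv0
  set a := (∫ ω, X ω * U ω ∂P) / v with ha
  set b := (∫ ω, X ω * V ω ∂P) / v with hb
  set c := (∫ ω, X ω * W ω ∂P) / v with hc
  have hres : ∀ {Y : Ω → ℝ} (_ : Y ∈ H), (Y - ((∫ ω, X ω * Y ω ∂P) / v) • X) ∈ H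
      ∧ ∫ ω, X ω * (Y - ((∫ ω, X ω * Y ω ∂P) / v) • X) ω ∂P = 0 := by
    intro Y hY
    refine ⟨H.sub_mem hY (H.smul_mem _ hX), ?_⟩
    have e : ∀ ω, X ω * (Y - ((∫ ω, X ω * Y ω ∂P) / v) • X) ω
        = X ω * Y ω - ((∫ ω, X ω * Y ω ∂P) / v) * X ω ^ 2 := fun ω => by
      simp
      ring
    simp only [e]
    rw [integral_sub (mX.mul (hH.hasMoments hY)).integrable ((mX.pow 2).const_mul _).integrable,
      integral_const_mul, ← hv2]
    field_simp
    simp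
  set Y : Fin 3 → Ω → ℝ := ![U - a • X, V - b • X, W - c • X] with hYdef
  have hYH : ∀ i, Y i ∈ H := by
    intro i
    fin_cases i
    exacts [(hres hU).1, (hres hV).1, (hres hW).1]
  have hYX : ∀ i, ∫ ω, X ω * Y i ω ∂P = 0 := by
    intro i
    fin_cases i
    exacts [(hres hU).2, (hres hV).2, (hres hW).2]
  have hmX := (hH X hX).1
  have hmY : Measurable fun ω i => Y i ω := measurable_pi_lambda _ fun i => (hH _ (hYH i)).1
  have hprod := (indepFun_iff_map_prod_eq_prod_map_map hmX.aemeasurable hmY.aemeasurable).mp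
    (hH.indepFun hX hYH hYX)
  rw [hv] at hprod
  set ν := P.map fun ω i => Y i ω
  have : IsProbabilityMeasure ν := Measure.isProbabilityMeasure_map hmY.aemeasurable
  -- transfer of integrals to the product law
  have transfer : ∀ F : ℝ → (Fin 3 → ℝ) → ℝ, Continuous (fun z : ℝ × (Fin 3 → ℝ) => F z.1 z.2) →
      Integrable (fun ω => F (X ω) fun i => Y i ω) P →
      ∫ ω, F (X ω) (fun i => Y i ω) ∂P = ∫ y, ∫ x, F x y ∂(gaussianReal 0 v) ∂ν := by
    intro F hF hint
    have hFm := hF.measurable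
    rw [← integral_prod_symm (f := fun z : ℝ × (Fin 3 → ℝ) => F z.1 z.2), ← hprod,
      integral_map (hmX.prodMk hmY).aemeasurable hFm.aestronglyMeasurable]
    rw [← hprod, integrable_map_measure hFm.aestronglyMeasurable (hmX.prodMk hmY).aemeasurable]
    exact hint
  set T : ℝ → (Fin 3 → ℝ) → ℕ → ℕ → ℕ → ℝ := fun x y p q r =>
    (a * x + y 0) ^ p * (b * x + y 1) ^ q * (c * x + y 2) ^ r with hT
  have hTe : ∀ ω p q r, T (X ω) (fun i => Y i ω) p q r = U ω ^ p * V ω ^ q * W ω ^ r := by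
    intro ω p q r
    simp [hT, hYdef]
  have hTi : ∀ p q r, HasMoments (fun ω => U ω ^ p * V ω ^ q * W ω ^ r) P := fun p q r =>
    ((mU.pow p).mul (mV.pow q)).mul (mW.pow r)
  have hTc : ∀ p q r, Continuous (fun z : ℝ × (Fin 3 → ℝ) => T z.1 z.2 p q r) := by
    intro p q r
    simp only [hT]
    fun_prop
  have lhs := transfer (fun x y => x * T x y p q r) (continuous_fst.mul (hTc p q r)) (by
    simpa only [hTe] using (mX.mul (hTi p q r)).integrable)
  have rhs := transfer (fun x y => p * a * T x y (p - 1) q r + q * b * T x y p (q - 1) r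
      + r * c * T x y p q (r - 1)) (by
        exact ((continuous_const.mul (hTc _ _ _)).add (continuous_const.mul (hTc _ _ _))).add
          (continuous_const.mul (hTc _ _ _))) (by
      simpa only [hTe] using ((((hTi _ _ _).const_mul _).add ((hTi _ _ _).const_mul _)).add
        ((hTi _ _ _).const_mul _)).integrable)
  have stein : ∀ y, ∫ x, x * T x y p q r ∂(gaussianReal 0 v)
      = v * ∫ x, (p * a * T x y (p - 1) q r + q * b * T x y p (q - 1) r
      + r * c * T x y p q (r - 1)) ∂(gaussianReal 0 v) := by
    intro y
    set Q : Polynomial ℝ := (Polynomial.C a * Polynomial.X + Polynomial.C (y 0)) ^ p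
      * (Polynomial.C b * Polynomial.X + Polynomial.C (y 1)) ^ q
      * (Polynomial.C c * Polynomial.X + Polynomial.C (y 2)) ^ r with hQ
    have e1 : ∀ x, T x y p q r = Q.eval x := fun x => by simp [hT, hQ]
    have e2 : ∀ x, (p * a * T x y (p - 1) q r + q * b * T x y p (q - 1) r
      + r * c * T x y p q (r - 1)) = Q.derivative.eval x := fun x => by
      simp [hT, hQ, Polynomial.derivative_pow]
      ring
    simp only [e1, e2]
    exact integral_mul_eval_gaussianReal Q v
  simp only [stein, integral_const_mul, ← rhs] at lhs
  simp only [hTe] at lhs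
  rw [lhs, integral_add (((hTi _ _ _).const_mul _).add ((hTi _ _ _).const_mul _)).integrable
    ((hTi _ _ _).const_mul _).integrable, integral_add ((hTi _ _ _).const_mul _).integrable
    ((hTi _ _ _).const_mul _).integrable, integral_const_mul, integral_const_mul,
    integral_const_mul, ha, hb, hc]
  field_simp

end IsGaussianSpace

lemma HasMoments.abs_integral_mul_le {Ω : Type*} [MeasurableSpace Ω] {P : Measure Ω}
    [IsFiniteMeasure P] {X Y : Ω → ℝ} (mX : HasMoments X P) (mY : HasMoments Y P) {a b : ℝ}
    (ha : 0 ≤ a) (hb : 0 ≤ b)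
    (hX : ∫ ω, X ω ^ 2 ∂P ≤ a ^ 2) (hY : ∫ ω, Y ω ^ 2 ∂P ≤ b ^ 2) :
    |∫ ω, X ω * Y ω ∂P| ≤ a * b := by
  have h := discrim_le_zero (a := ∫ ω, Y ω ^ 2 ∂P) (b := 2 * ∫ ω, X ω * Y ω ∂P)
    (c := ∫ ω, X ω ^ 2 ∂P) fun t => by
      have e : ∀ ω, (t * Y ω + X ω) ^ 2 = t * t * Y ω ^ 2 + 2 * t * (X ω * Y ω) + X ω ^ 2 :=
        fun ω => by ring
      have h0 : 0 ≤ ∫ ω, (t * Y ω + X ω) ^ 2 ∂P := integral_nonneg fun ω => sq_nonneg _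
      simp only [e] at h0
      rw [integral_add (((mY.pow 2).const_mul _).add ((mX.mul mY).const_mul _)).integrable
        (mX.pow 2).integrable, integral_add ((mY.pow 2).const_mul _).integrable
        ((mX.mul mY).const_mul _).integrable, integral_const_mul, integral_const_mul] at h0
      linarith
  have h1 : (∫ ω, X ω * Y ω ∂P) ^ 2 ≤ (a * b) ^ 2 := by
    have : (∫ ω, X ω ^ 2 ∂P) * (∫ ω, Y ω ^ 2 ∂P) ≤ a ^ 2 * b ^ 2 :=
      mul_le_mul hX hY (integral_nonneg fun ω => sq_nonneg _) (sq_nonneg a)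
    rw [discrim] at h
    nlinarith
  exact abs_le_of_sq_le_sq h1 (mul_nonneg ha hb)

namespace IsGaussianSpace

variable {Ω : Type*} [MeasurableSpace Ω] {P : Measure Ω} [IsProbabilityMeasure P]
  {H : Submodule ℝ (Ω → ℝ)}

lemma abs_integral_mul_le (hH : IsGaussianSpace H P) {X Y : Ω → ℝ} (hX : X ∈ H) (hY : Y ∈ H)
    {a b : ℝ} (ha : 0 ≤ a) (hb : 0 ≤ b)
    (hXa : ∫ ω, X ω ^ 2 ∂P ≤ a ^ 2) (hYb : ∫ ω, Y ω ^ 2 ∂P ≤ b ^ 2) :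
    |∫ ω, X ω * Y ω ∂P| ≤ a * b :=
  (hH.hasMoments hX).abs_integral_mul_le (hH.hasMoments hY) ha hb hXa hYb

lemma abs_integral_pow_mul_pow_mul_pow_le (hH : IsGaussianSpace H P) (n : ℕ) :
    ∀ {U V W : Ω → ℝ} {a b c : ℝ} (p q r : ℕ), p + q + r = n → U ∈ H → V ∈ H → W ∈ H →
      0 ≤ a → 0 ≤ b → 0 ≤ c → ∫ ω, U ω ^ 2 ∂P ≤ a ^ 2 → ∫ ω, V ω ^ 2 ∂P ≤ b ^ 2 →
      ∫ ω, W ω ^ 2 ∂P ≤ c ^ 2 →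
      |∫ ω, U ω ^ p * V ω ^ q * W ω ^ r ∂P| ≤ n.factorial * (a ^ p * b ^ q * c ^ r) := by
  induction n using Nat.strong_induction_on with
  | _ n ih =>
  have step : ∀ {U V W : Ω → ℝ} {a b c : ℝ} (p q r : ℕ), p + 1 + q + r = n → U ∈ H → V ∈ H →
      W ∈ H → 0 ≤ a → 0 ≤ b → 0 ≤ c → ∫ ω, U ω ^ 2 ∂P ≤ a ^ 2 → ∫ ω, V ω ^ 2 ∂P ≤ b ^ 2 →
      ∫ ω, W ω ^ 2 ∂P ≤ c ^ 2 →
      |∫ ω, U ω ^ (p + 1) * V ω ^ q * W ω ^ r ∂P|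
        ≤ n.factorial * (a ^ (p + 1) * b ^ q * c ^ r) := by
    intro U V W a b c p q r hn hU hV hW ha hb hc hUa hVb hWc
    obtain ⟨k, rfl⟩ : ∃ k, n = k + 1 := ⟨p + q + r, by omega⟩
    have e : ∀ ω, U ω ^ (p + 1) * V ω ^ q * W ω ^ r = U ω * (U ω ^ p * V ω ^ q * W ω ^ r) :=
      fun ω => by ring
    simp only [e]
    rw [hH.integral_mul_pow_mul_pow_mul_pow hU hU hV hW]
    have hUU := hH.abs_integral_mul_le hU hU ha ha hUa hUa
    have hUV := hH.abs_integral_mul_le hU hV ha hb hUa hVb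
    have hUW := hH.abs_integral_mul_le hU hW ha hc hUa hWc
    set F : ℝ := (k.factorial : ℝ) * (a ^ (p + 1) * b ^ q * c ^ r) with hF
    have hfac : ((k - 1).factorial : ℝ) ≤ k.factorial := by
      exact_mod_cast Nat.factorial_le (Nat.sub_le k 1)
    have t1 : |(p : ℝ) * (∫ ω, U ω * U ω ∂P) * ∫ ω, U ω ^ (p - 1) * V ω ^ q * W ω ^ r ∂P|
        ≤ p * F := by
      rcases p with _ | p
      · simp
      have := ih (k - 1) (by omega) p q r (by omega) hU hV hW ha hb hc hUa hVb hWc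
      rw [mul_assoc, abs_mul, abs_mul, abs_of_nonneg (Nat.cast_nonneg (p + 1)),
        Nat.add_sub_cancel]
      refine mul_le_mul_of_nonneg_left ?_ (by positivity)
      calc _ ≤ a * a * ((k - 1).factorial * (a ^ p * b ^ q * c ^ r)) := by gcongr
        _ ≤ a * a * (k.factorial * (a ^ p * b ^ q * c ^ r)) := by gcongr
        _ = F := by rw [hF]; ring
    have t2 : |(q : ℝ) * (∫ ω, U ω * V ω ∂P) * ∫ ω, U ω ^ p * V ω ^ (q - 1) * W ω ^ r ∂P|
        ≤ q * F := by
      rcases q with _ | q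
      · simp
      have := ih (k - 1) (by omega) p q r (by omega) hU hV hW ha hb hc hUa hVb hWc
      rw [mul_assoc, abs_mul, abs_mul, abs_of_nonneg (Nat.cast_nonneg (q + 1)),
        Nat.add_sub_cancel]
      refine mul_le_mul_of_nonneg_left ?_ (by positivity)
      calc _ ≤ a * b * ((k - 1).factorial * (a ^ p * b ^ q * c ^ r)) := by gcongr
        _ ≤ a * b * (k.factorial * (a ^ p * b ^ q * c ^ r)) := by gcongr
        _ = F := by rw [hF]; ring
    have t3 : |(r : ℝ) * (∫ ω, U ω * W ω ∂P) * ∫ ω, U ω ^ p * V ω ^ q * W ω ^ (r - 1) ∂P|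
        ≤ r * F := by
      rcases r with _ | r
      · simp
      have := ih (k - 1) (by omega) p q r (by omega) hU hV hW ha hb hc hUa hVb hWc
      rw [mul_assoc, abs_mul, abs_mul, abs_of_nonneg (Nat.cast_nonneg (r + 1)),
        Nat.add_sub_cancel]
      refine mul_le_mul_of_nonneg_left ?_ (by positivity)
      calc _ ≤ a * c * ((k - 1).factorial * (a ^ p * b ^ q * c ^ r)) := by gcongr
        _ ≤ a * c * (k.factorial * (a ^ p * b ^ q * c ^ r)) := by gcongr
        _ = F := by rw [hF]; ring
    refine (abs_add_three _ _ _).trans ?_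
    have hF0 : 0 ≤ F := by positivity
    have hk : (p : ℝ) + q + r = k := by
      have : p + q + r = k := by omega
      exact_mod_cast this
    calc _ ≤ p * F + q * F + r * F := add_le_add (add_le_add t1 t2) t3
      _ = k * F := by rw [← hk]; ring
      _ ≤ (k + 1) * F := by gcongr; linarith
      _ = _ := by rw [hF, Nat.factorial_succ]; push_cast; ring
  intro U V W a b c p q r hn hU hV hW ha hb hc hUa hVb hWc
  rcases p with _ | p
  · rcases q with _ | q
    · rcases r with _ | r
      · simp
        exact_mod_cast Nat.one_le_iff_ne_zero.mpr (Nat.factorial_ne_zero n)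
      · convert! step r 0 0 (by omega) hW hV hU hc hb ha hWc hVb hUa using 2
        · simp
        · ring
    · convert! step q 0 r (by omega) hV hU hW hb ha hc hVb hUa hWc using 2
      · simp
      · ring
  · exact step p q r hn hU hV hW ha hb hc hUa hVb hWc

/-- Fifth powers of two Gaussian variables are almost uncorrelated if the variables are. -/
lemma abs_integral_pow_five_mul_pow_five_le (hH : IsGaussianSpace H P) {Y Z : Ω → ℝ}
    (hY : Y ∈ H) (hZ : Z ∈ H) {σ : ℝ} (hσ : 0 ≤ σ)
    (hYσ : ∫ ω, Y ω ^ 2 ∂P ≤ σ ^ 2) (hZσ : ∫ ω, Z ω ^ 2 ∂P ≤ σ ^ 2) :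
    |∫ ω, Y ω ^ 5 * Z ω ^ 5 ∂P| ≤ 216960 * |∫ ω, Y ω * Z ω ∂P| * σ ^ 8 := by
  have wick : ∀ q r : ℕ, ∫ ω, Y ω ^ (q + 1) * Z ω ^ (r + 1) ∂P
      = q * (∫ ω, Y ω ^ 2 ∂P) * (∫ ω, Y ω ^ (q - 1) * Z ω ^ (r + 1) ∂P)
        + (r + 1) * (∫ ω, Y ω * Z ω ∂P) * (∫ ω, Y ω ^ q * Z ω ^ r ∂P) := by
    intro q r
    have := hH.integral_mul_pow_mul_pow_mul_pow hY hY hY hZ 0 q (r + 1)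
    simp only [Nat.cast_zero, zero_mul, zero_add, pow_zero, one_mul, Nat.add_sub_cancel,
      Nat.cast_add, Nat.cast_one, ← sq] at this
    rw [← this]
    congr 1 with ω
    ring
  have bd : ∀ n q r : ℕ, q + r = n →
      |∫ ω, Y ω ^ q * Z ω ^ r ∂P| ≤ n.factorial * (σ ^ q * σ ^ r) := by
    intro n q r hn
    simpa using hH.abs_integral_pow_mul_pow_mul_pow_le n 0 q r (by omega) hY hY hZ hσ hσ hσ
      hYσ hYσ hZσ
  set c := ∫ ω, Y ω * Z ω ∂P
  have hYa : |∫ ω, Y ω ^ 2 ∂P| ≤ σ ^ 2 := by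
    rwa [abs_of_nonneg (integral_nonneg fun ω => sq_nonneg _)]
  have h1 : |∫ ω, Y ω ^ 1 * Z ω ^ 5 ∂P| ≤ 120 * |c| * σ ^ 4 := by
    have h := wick 0 4
    have hb := bd 4 0 4 rfl
    norm_num [Nat.factorial] at h hb
    norm_num
    rw [h, abs_mul, abs_mul]
    norm_num
    nlinarith [mul_le_mul_of_nonneg_left hb (abs_nonneg c)]
  have h3 : |∫ ω, Y ω ^ 3 * Z ω ^ 5 ∂P| ≤ 3840 * |c| * σ ^ 6 := by
    have h := wick 2 4
    have hb := bd 6 2 4 rfl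
    norm_num [Nat.factorial] at h hb h1
    rw [h]
    refine (abs_add_le _ _).trans ?_
    simp only [abs_mul]
    norm_num
    nlinarith [mul_le_mul_of_nonneg_left hb (abs_nonneg c),
      mul_le_mul hYa h1 (abs_nonneg _) (sq_nonneg σ)]
  have h := wick 4 4
  have hb := bd 8 4 4 rfl
  norm_num [Nat.factorial] at h hb
  rw [h]
  refine (abs_add_le _ _).trans ?_
  simp only [abs_mul]
  norm_num
  nlinarith [mul_le_mul_of_nonneg_left hb (abs_nonneg c),
    mul_le_mul hYa h3 (abs_nonneg _) (sq_nonneg σ)]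

lemma abs_integral_mul_mul_pow_five_mul_pow_five_le (hH : IsGaussianSpace H P)
    {U V Y Z : Ω → ℝ} (hU : U ∈ H) (hV : V ∈ H) (hY : Y ∈ H) (hZ : Z ∈ H) {w σ : ℝ} (hw : 0 ≤ w)
    (hσ : 0 ≤ σ) (hUw : ∫ ω, U ω ^ 2 ∂P ≤ w ^ 2) (hVw : ∫ ω, V ω ^ 2 ∂P ≤ w ^ 2)
    (hYσ : ∫ ω, Y ω ^ 2 ∂P ≤ σ ^ 2) (hZσ : ∫ ω, Z ω ^ 2 ∂P ≤ σ ^ 2) :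
    |∫ ω, U ω * (V ω * Y ω ^ 5 * Z ω ^ 5) ∂P|
      ≤ 216960 * w ^ 2 * |∫ ω, Y ω * Z ω ∂P| * σ ^ 8
        + 18144000 * w * σ ^ 9 * (|∫ ω, U ω * Y ω ∂P| + |∫ ω, U ω * Z ω ∂P|) := by
  have h := hH.integral_mul_pow_mul_pow_mul_pow hU hV hY hZ 1 5 5
  have h5 := hH.abs_integral_pow_five_mul_pow_five_le hY hZ hσ hYσ hZσ
  have hUV := hH.abs_integral_mul_le hU hV hw hw hUw hVw
  have b1 := hH.abs_integral_pow_mul_pow_mul_pow_le 10 1 4 5 rfl hV hY hZ hw hσ hσ hVw hYσ hZσ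
  have b2 := hH.abs_integral_pow_mul_pow_mul_pow_le 10 1 5 4 rfl hV hY hZ hw hσ hσ hVw hYσ hZσ
  norm_num [Nat.factorial] at h b1 b2
  rw [h]
  refine (abs_add_three _ _ _).trans ?_
  simp only [abs_mul]
  norm_num
  have e1 := mul_le_mul hUV h5 (abs_nonneg _) (mul_nonneg hw hw)
  have e2 := mul_le_mul_of_nonneg_left b1 (abs_nonneg (∫ ω, U ω * Y ω ∂P))
  have e3 := mul_le_mul_of_nonneg_left b2 (abs_nonneg (∫ ω, U ω * Z ω ∂P))
  linarith

lemma integral_sum_pow_five_sq_le (hH : IsGaussianSpace H P) {h : ℕ → Ω → ℝ} {m : ℕ}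
    (hh : ∀ i, h i ∈ H) {σ : ℝ} (hσ : 0 ≤ σ) (hhσ : ∀ i, ∫ ω, h i ω ^ 2 ∂P ≤ σ ^ 2) :
    ∫ ω, (∑ i ∈ Finset.range m, h i ω ^ 5) ^ 2 ∂P
      ≤ 216960 * σ ^ 8
        * ∑ i ∈ Finset.range m, ∑ j ∈ Finset.range m, |∫ ω, h i ω * h j ω ∂P| := by
  have mh := fun i => hH.hasMoments (hh i)
  simp only [sq, Finset.sum_mul_sum]
  have hi : ∀ i j, HasMoments (fun ω => h i ω ^ 5 * h j ω ^ 5) P := fun i j =>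
    ((mh i).pow 5).mul ((mh j).pow 5)
  rw [integral_finsetSum _ fun i _ => (HasMoments.sum _ fun j _ => hi i j).integrable,
    Finset.mul_sum]
  refine Finset.sum_le_sum fun i _ => ?_
  rw [integral_finsetSum _ fun j _ => (hi i j).integrable, Finset.mul_sum]
  refine Finset.sum_le_sum fun j _ => ?_
  have := hH.abs_integral_pow_five_mul_pow_five_le (hh i) (hh j) hσ (hhσ i) (hhσ j)
  linarith [le_abs_self (∫ ω, h i ω ^ 5 * h j ω ^ 5 ∂P)]

lemma integral_sum_mul_pow_five_sq_le (hH : IsGaussianSpace H P) {h W : ℕ → Ω → ℝ} {m : ℕ}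
    (hh : ∀ i, h i ∈ H) (hW : ∀ i, W i ∈ H) {w σ : ℝ} (hw : 0 ≤ w) (hσ : 0 ≤ σ)
    (hhσ : ∀ i, ∫ ω, h i ω ^ 2 ∂P ≤ σ ^ 2) (hWw : ∀ i < m, ∫ ω, W i ω ^ 2 ∂P ≤ w ^ 2) :
    ∫ ω, (∑ i ∈ Finset.range m, W i ω * h i ω ^ 5) ^ 2 ∂P
      ≤ 216960 * w ^ 2 * σ ^ 8
          * ∑ i ∈ Finset.range m, ∑ j ∈ Finset.range m, |∫ ω, h i ω * h j ω ∂P|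
        + 18144000 * w * σ ^ 9 * ∑ i ∈ Finset.range m, ∑ j ∈ Finset.range m,
          (|∫ ω, W i ω * h i ω ∂P| + |∫ ω, W i ω * h j ω ∂P|) := by
  have mh := fun i => hH.hasMoments (hh i)
  have mW := fun i => hH.hasMoments (hW i)
  simp only [sq (Finset.sum _ _), Finset.sum_mul_sum]
  have hi : ∀ i j, HasMoments (fun ω => W i ω * h i ω ^ 5 * (W j ω * h j ω ^ 5)) P := fun i j =>
    ((mW i).mul ((mh i).pow 5)).mul ((mW j).mul ((mh j).pow 5))
  rw [integral_finsetSum _ fun i _ => (HasMoments.sum _ fun j _ => hi i j).integrable,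
    Finset.mul_sum, Finset.mul_sum, ← Finset.sum_add_distrib]
  refine Finset.sum_le_sum fun i hi' => ?_
  rw [integral_finsetSum _ fun j _ => (hi i j).integrable, Finset.mul_sum, Finset.mul_sum,
    ← Finset.sum_add_distrib]
  refine Finset.sum_le_sum fun j hj' => ?_
  have := hH.abs_integral_mul_mul_pow_five_mul_pow_five_le (hW i) (hW j) (hh i) (hh j) hw hσ
    (hWw i (Finset.mem_range.mp hi')) (hWw j (Finset.mem_range.mp hj')) (hhσ i) (hhσ j)
  have e : ∀ ω, W i ω * h i ω ^ 5 * (W j ω * h j ω ^ 5)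
      = W i ω * (W j ω * h i ω ^ 5 * h j ω ^ 5) := fun ω => by ring
  simp only [e]
  linarith [le_abs_self (∫ ω, W i ω * (W j ω * h i ω ^ 5 * h j ω ^ 5) ∂P)]

end IsGaussianSpace

/-- `|x| ^ (1 / 3)`. -/
def absCbrt (x : ℝ) : ℝ := |x| ^ ((1 : ℝ) / 3)

lemma absCbrt_nonneg (x : ℝ) : 0 ≤ absCbrt x := Real.rpow_nonneg (abs_nonneg x) _

@[simp] lemma absCbrt_neg (x : ℝ) : absCbrt (-x) = absCbrt x := by simp [absCbrt]

@[simp] lemma absCbrt_zero : absCbrt 0 = 0 := by simp [absCbrt]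

@[simp] lemma absCbrt_one : absCbrt 1 = 1 := by simp [absCbrt]

lemma absCbrt_mono {x y : ℝ} (hx : 0 ≤ x) (h : x ≤ y) : absCbrt x ≤ absCbrt y := by
  rw [absCbrt, absCbrt, abs_of_nonneg hx, abs_of_nonneg (hx.trans h)]
  exact Real.rpow_le_rpow hx h (by norm_num)

/-- Increment of `absCbrt` over `[k, k + 1]`. -/
def cbrtInc (k : ℕ) : ℝ := absCbrt (k + 1) - absCbrt k

lemma cbrtInc_nonneg (k : ℕ) : 0 ≤ cbrtInc k :=
  sub_nonneg.mpr (absCbrt_mono (Nat.cast_nonneg k) (by linarith))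

lemma cbrtInc_succ_le (k : ℕ) : cbrtInc (k + 1) ≤ cbrtInc k := by
  obtain ⟨-, hc⟩ := Real.concaveOn_rpow (p := (1 : ℝ) / 3) (by norm_num) (by norm_num)
  have h := hc (x := (k : ℝ)) (Set.mem_Ici.mpr (by positivity)) (y := (k : ℝ) + 2)
    (Set.mem_Ici.mpr (by positivity)) (a := 1 / 2) (b := 1 / 2) (by norm_num) (by norm_num)
    (by norm_num)
  have e : (1 / 2 : ℝ) • (k : ℝ) + (1 / 2 : ℝ) • ((k : ℝ) + 2) = k + 1 := by
    simp only [smul_eq_mul]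
    ring
  rw [e] at h
  simp only [smul_eq_mul] at h
  have h2 : ((k : ℝ) + 1 + 1) = k + 2 := by ring
  simp only [cbrtInc, absCbrt, Nat.cast_add, Nat.cast_one, h2]
  rw [abs_of_nonneg (by positivity : (0 : ℝ) ≤ k), abs_of_nonneg (by positivity : (0 : ℝ) ≤ k + 1),
    abs_of_nonneg (by positivity : (0 : ℝ) ≤ k + 2)]
  linarith

lemma sum_cbrtInc (m : ℕ) : ∑ k ∈ Finset.range m, cbrtInc k = absCbrt m := by
  simpa [cbrtInc] using Finset.sum_range_sub (fun k : ℕ => absCbrt k) m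

lemma sum_sub_le_sum_add_neg {F : ℝ → ℝ} (hF : ∀ x, 0 ≤ F x) {i m : ℕ} (him : i ≤ m) :
    ∑ j ∈ Finset.range m, F ((i : ℝ) - j)
      ≤ ∑ k ∈ Finset.range (m + 1), F k + ∑ k ∈ Finset.range (m + 1), F (-(k : ℝ)) := by
  obtain ⟨r, rfl⟩ := Nat.exists_eq_add_of_le him
  rw [Finset.sum_range_add]
  refine add_le_add ?_ ?_
  · rw [← Finset.sum_range_reflect]
    have e : ∀ k ∈ Finset.range i, F ((i : ℝ) - ((i - 1 - k : ℕ) : ℝ)) = F ((k + 1 : ℕ) : ℝ) := by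
      intro k hk
      have : i - 1 - k + (k + 1) = i := by
        have := Finset.mem_range.mp hk
        omega
      congr 1
      rw [sub_eq_iff_eq_add']
      exact_mod_cast this.symm
    rw [Finset.sum_congr rfl e]
    have := Finset.sum_range_succ' (fun k : ℕ => F (k : ℝ)) i
    have h2 : ∑ k ∈ Finset.range (i + 1), F (k : ℝ) ≤ ∑ k ∈ Finset.range (i + r + 1), F (k : ℝ) :=
      Finset.sum_le_sum_of_subset_of_nonneg
        (Finset.range_subset_range.mpr (by omega)) fun _ _ _ => hF _
    have h3 := hF ((0 : ℕ) : ℝ)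
    linarith
  · have e : ∀ k ∈ Finset.range r, F ((i : ℝ) - ((i + k : ℕ) : ℝ)) = F (-(k : ℝ)) := by
      intro k _
      congr 1
      push_cast
      ring
    rw [Finset.sum_congr rfl e]
    exact Finset.sum_le_sum_of_subset_of_nonneg
        (Finset.range_subset_range.mpr (by omega)) fun _ _ _ => hF _

lemma sum_abs_second_difference_le {i m : ℕ} (him : i ≤ m) :
    ∑ j ∈ Finset.range m, |absCbrt ((i : ℝ) - j + 1) + absCbrt ((i : ℝ) - j - 1)
      - 2 * absCbrt ((i : ℝ) - j)| ≤ 6 := by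
  set F : ℝ → ℝ := fun x => |absCbrt (x + 1) + absCbrt (x - 1) - 2 * absCbrt x| with hF
  have heven : ∀ x, F (-x) = F x := by
    intro x
    have e1 : -x + 1 = -(x - 1) := by ring
    have e2 : -x - 1 = -(x + 1) := by ring
    simp only [hF]
    rw [e1, e2, absCbrt_neg, absCbrt_neg, absCbrt_neg, add_comm (absCbrt (x - 1))]
  refine (sum_sub_le_sum_add_neg (F := F) (fun x => abs_nonneg _) him).trans ?_
  simp only [heven]
  have hs : ∀ k : ℕ, F ((k + 1 : ℕ) : ℝ) = cbrtInc k - cbrtInc (k + 1) := by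
    intro k
    have h := cbrtInc_succ_le k
    simp only [hF, cbrtInc, Nat.cast_add, Nat.cast_one, add_sub_cancel_right] at h ⊢
    rw [abs_of_nonpos (by linarith)]
    ring
  have h0 : F ((0 : ℕ) : ℝ) = 2 := by
    simp [hF]
    norm_num
  rw [Finset.sum_range_succ', h0]
  simp only [hs]
  rw [Finset.sum_range_sub']
  have h1 := cbrtInc_nonneg m
  have h2 : cbrtInc 0 = 1 := by simp [cbrtInc]
  linarith

lemma sum_abs_difference_le {i m : ℕ} (him : i ≤ m) :
    ∑ j ∈ Finset.range m, |absCbrt ((i : ℝ) - j) - absCbrt ((i : ℝ) - j - 1)|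
      ≤ 2 + 2 * absCbrt m := by
  set F : ℝ → ℝ := fun x => |absCbrt x - absCbrt (x - 1)| with hF
  refine (sum_sub_le_sum_add_neg (F := F) (fun x => abs_nonneg _) him).trans ?_
  have hneg : ∀ k : ℕ, F (-(k : ℝ)) = cbrtInc k := by
    intro k
    have e : -(k : ℝ) - 1 = -(k + 1) := by ring
    simp only [hF]
    rw [e, absCbrt_neg, absCbrt_neg, abs_sub_comm, ← cbrtInc, abs_of_nonneg (cbrtInc_nonneg k)]
  have hs : ∀ k : ℕ, F ((k + 1 : ℕ) : ℝ) = cbrtInc k := by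
    intro k
    simp only [hF, Nat.cast_add, Nat.cast_one, add_sub_cancel_right]
    rw [← cbrtInc, abs_of_nonneg (cbrtInc_nonneg k)]
  have h0 : F ((0 : ℕ) : ℝ) = 1 := by simp [hF]
  have hle : cbrtInc m ≤ 1 := by
    have h2 : cbrtInc 0 = 1 := by simp [cbrtInc]
    rw [← h2]
    exact antitone_nat_of_succ_le cbrtInc_succ_le (Nat.zero_le m)
  rw [Finset.sum_range_succ', h0]
  simp only [hs, hneg]
  rw [Finset.sum_range_succ, sum_cbrtInc]
  linarith

lemma one_le_absCbrt {m : ℕ} (hm : 0 < m) : 1 ≤ absCbrt m := by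
  rw [← absCbrt_one]
  exact absCbrt_mono zero_le_one (by exact_mod_cast hm)

/-- The covariance of fractional Brownian motion with Hurst parameter `1 / 6` along a grid of
mesh `δ ^ 3`. -/
def IsFBMGrid {Ω : Type*} [MeasurableSpace Ω] (X : ℕ → Ω → ℝ) (δ : ℝ) (P : Measure Ω) : Prop :=
  ∀ i j : ℕ, ∫ ω, X i ω * X j ω ∂P
    = δ / 2 * (absCbrt i + absCbrt j - absCbrt ((i : ℝ) - j))

namespace IsFBMGrid

variable {Ω : Type*} [MeasurableSpace Ω] {P : Measure Ω} {X : ℕ → Ω → ℝ} {δ : ℝ}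

lemma integral_sub_mul_sub (hX : IsFBMGrid X δ P) (mX : ∀ i, HasMoments (X i) P) (a b c d : ℕ) :
    ∫ ω, (X a ω - X b ω) * (X c ω - X d ω) ∂P
      = δ / 2 * (absCbrt ((a : ℝ) - d) + absCbrt ((b : ℝ) - c) - absCbrt ((a : ℝ) - c)
        - absCbrt ((b : ℝ) - d)) := by
  have hi : ∀ i j, HasMoments (fun ω => X i ω * X j ω) P := fun i j => (mX i).mul (mX j)
  have e : ∀ ω, (X a ω - X b ω) * (X c ω - X d ω)
      = X a ω * X c ω - X a ω * X d ω - X b ω * X c ω + X b ω * X d ω := fun ω => by ring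
  simp only [e]
  rw [integral_add (((hi _ _).sub (hi _ _)).sub (hi _ _)).integrable (hi _ _).integrable,
    integral_sub ((hi _ _).sub (hi _ _)).integrable (hi _ _).integrable,
    integral_sub (hi _ _).integrable (hi _ _).integrable, hX, hX, hX, hX]
  ring

lemma integral_sub_sq (hX : IsFBMGrid X δ P) (mX : ∀ i, HasMoments (X i) P) (q i : ℕ) :
    ∫ ω, (X (q + i) ω - X q ω) ^ 2 ∂P = δ * absCbrt i := by
  have e : (q : ℝ) - (q + i : ℕ) = -i := by
    push_cast
    ring
  simp only [sq]
  rw [hX.integral_sub_mul_sub mX, e]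
  simp
  ring

lemma integral_seqInc_sq (hX : IsFBMGrid X δ P) (mX : ∀ i, HasMoments (X i) P) (j : ℕ) :
    ∫ ω, seqInc (fun k => X k ω) j ^ 2 ∂P = δ := by
  simpa [seqInc] using hX.integral_sub_sq mX j 1

lemma hasMoments_seqInc (mX : ∀ i, HasMoments (X i) P) (j : ℕ) :
    HasMoments (fun ω => seqInc (fun k => X k ω) j) P :=
  (mX _).sub (mX _)

lemma hasMoments_seqMid (mX : ∀ i, HasMoments (X i) P) (q i : ℕ) :
    HasMoments (fun ω => seqMid (fun k => X k ω) q i) P :=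
  (((mX _).add (mX _)).div_const 2).sub (mX _)

lemma sum_abs_integral_seqInc_mul_le (hX : IsFBMGrid X δ P) (mX : ∀ i, HasMoments (X i) P)
    (hδ : 0 ≤ δ) (q m : ℕ) :
    ∑ i ∈ Finset.range m, ∑ j ∈ Finset.range m,
      |∫ ω, seqInc (fun k => X k ω) (q + i) * seqInc (fun k => X k ω) (q + j) ∂P|
      ≤ 3 * m * δ := by
  have hterm : ∀ i j : ℕ,
      |∫ ω, seqInc (fun k => X k ω) (q + i) * seqInc (fun k => X k ω) (q + j) ∂P|
      = δ / 2 * |absCbrt ((i : ℝ) - j + 1) + absCbrt ((i : ℝ) - j - 1)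
        - 2 * absCbrt ((i : ℝ) - j)| := by
    intro i j
    simp only [seqInc]
    rw [hX.integral_sub_mul_sub mX, abs_mul, abs_of_nonneg (by positivity : 0 ≤ δ / 2)]
    congr 2
    push_cast
    ring_nf
  have hi : ∀ i ∈ Finset.range m, ∑ j ∈ Finset.range m,
      |∫ ω, seqInc (fun k => X k ω) (q + i) * seqInc (fun k => X k ω) (q + j) ∂P| ≤ 3 * δ := by
    intro i hi
    simp only [hterm, ← Finset.mul_sum]
    have := sum_abs_second_difference_le (Finset.mem_range.mp hi).le
    nlinarith
  refine (Finset.sum_le_sum hi).trans (le_of_eq ?_)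
  simp
  ring

lemma sum_abs_integral_sub_mul_seqInc_le (hX : IsFBMGrid X δ P) (mX : ∀ i, HasMoments (X i) P)
    (hδ : 0 ≤ δ) (q : ℕ) {i m : ℕ} (hi : i ≤ m) (hm : 0 < m) :
    ∑ j ∈ Finset.range m,
      |∫ ω, (X (q + i) ω - X q ω) * seqInc (fun k => X k ω) (q + j) ∂P|
      ≤ 3 * δ * absCbrt m := by
  have hterm : ∀ j : ℕ,
      |∫ ω, (X (q + i) ω - X q ω) * seqInc (fun k => X k ω) (q + j) ∂P|
      ≤ δ / 2 * (|absCbrt ((i : ℝ) - j) - absCbrt ((i : ℝ) - j - 1)| + cbrtInc j) := by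
    intro j
    simp only [seqInc]
    rw [hX.integral_sub_mul_sub mX, abs_mul, abs_of_nonneg (by positivity : 0 ≤ δ / 2)]
    refine mul_le_mul_of_nonneg_left ?_ (by positivity)
    have e : absCbrt ((q + i : ℕ) - (q + j : ℕ)) + absCbrt ((q : ℝ) - (q + j + 1 : ℕ))
        - absCbrt ((q + i : ℕ) - (q + j + 1 : ℕ)) - absCbrt ((q : ℝ) - (q + j : ℕ))
        = (absCbrt ((i : ℝ) - j) - absCbrt ((i : ℝ) - j - 1)) + cbrtInc j := by
      have e1 : (q : ℝ) - (q + j + 1 : ℕ) = -((j : ℝ) + 1) := by push_cast; ring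
      have e2 : (q : ℝ) - (q + j : ℕ) = -(j : ℝ) := by push_cast; ring
      rw [e1, e2, absCbrt_neg, absCbrt_neg, cbrtInc]
      push_cast
      ring_nf
    rw [e]
    refine (abs_add_le _ _).trans ?_
    rw [abs_of_nonneg (cbrtInc_nonneg j)]
  refine (Finset.sum_le_sum fun j _ => hterm j).trans ?_
  rw [← Finset.mul_sum, Finset.sum_add_distrib, sum_cbrtInc]
  have h1 := sum_abs_difference_le hi
  have h2 := one_le_absCbrt hm
  nlinarith

lemma seqMid_eq (x : ℕ → ℝ) (q i : ℕ) :
    seqMid x q i = ((x (q + i) - x q) + (x (q + (i + 1)) - x q)) / 2 := by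
  rw [seqMid, ← add_assoc]
  ring

lemma integral_seqMid_mul (mX : ∀ i, HasMoments (X i) P) (q i : ℕ) {Z : Ω → ℝ}
    (mZ : HasMoments Z P) :
    ∫ ω, seqMid (fun k => X k ω) q i * Z ω ∂P
      = ((∫ ω, (X (q + i) ω - X q ω) * Z ω ∂P)
        + ∫ ω, (X (q + (i + 1)) ω - X q ω) * Z ω ∂P) / 2 := by
  rw [← integral_add (((mX _).sub (mX _)).mul mZ).integrable
    (((mX _).sub (mX _)).mul mZ).integrable, ← integral_div]
  congr 1 with ω
  rw [seqMid_eq]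
  ring

lemma sum_abs_integral_seqMid_mul_le (hX : IsFBMGrid X δ P) (mX : ∀ i, HasMoments (X i) P)
    (hδ : 0 ≤ δ) (q : ℕ) {m : ℕ} (hm : 0 < m) :
    ∑ i ∈ Finset.range m, ∑ j ∈ Finset.range m,
      (|∫ ω, seqMid (fun k => X k ω) q i * seqInc (fun k => X k ω) (q + i) ∂P|
        + |∫ ω, seqMid (fun k => X k ω) q i * seqInc (fun k => X k ω) (q + j) ∂P|)
      ≤ 4 * m * δ * absCbrt m := by
  have hdiag : ∀ i : ℕ,
      |∫ ω, seqMid (fun k => X k ω) q i * seqInc (fun k => X k ω) (q + i) ∂P|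
        = δ / 2 * cbrtInc i := by
    intro i
    have e1 : (q : ℝ) - (q + i + 1 : ℕ) = -((i : ℝ) + 1) := by push_cast; ring
    have e2 : (q : ℝ) - (q + i : ℕ) = -(i : ℝ) := by push_cast; ring
    have e3 : ((q + i : ℕ) : ℝ) - (q + i + 1 : ℕ) = -1 := by push_cast; ring
    have e4 : ((q + i + 1 : ℕ) : ℝ) - (q + i : ℕ) = 1 := by push_cast; ring
    rw [integral_seqMid_mul mX q i (hasMoments_seqInc mX _), ← add_assoc]
    simp only [seqInc]
    rw [hX.integral_sub_mul_sub mX, hX.integral_sub_mul_sub mX, e1, e2, e3, e4, sub_self, sub_self,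
      absCbrt_neg, absCbrt_neg, absCbrt_neg, absCbrt_one, absCbrt_zero,
      abs_of_nonneg]
    · rw [cbrtInc]
      ring
    · have := cbrtInc_nonneg i
      rw [cbrtInc] at this
      nlinarith
  have hoff : ∀ i ∈ Finset.range m, ∑ j ∈ Finset.range m,
      |∫ ω, seqMid (fun k => X k ω) q i * seqInc (fun k => X k ω) (q + j) ∂P|
        ≤ 3 * δ * absCbrt m := by
    intro i hi
    have hi' := Finset.mem_range.mp hi
    have h1 := hX.sum_abs_integral_sub_mul_seqInc_le mX hδ q hi'.le hm
    have h2 := hX.sum_abs_integral_sub_mul_seqInc_le mX hδ q (Nat.succ_le_of_lt hi') hm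
    have hterm : ∀ j ∈ Finset.range m,
        |∫ ω, seqMid (fun k => X k ω) q i * seqInc (fun k => X k ω) (q + j) ∂P|
        ≤ (|∫ ω, (X (q + i) ω - X q ω) * seqInc (fun k => X k ω) (q + j) ∂P|
          + |∫ ω, (X (q + (i + 1)) ω - X q ω) * seqInc (fun k => X k ω) (q + j) ∂P|) / 2 := by
      intro j _
      rw [integral_seqMid_mul mX q i (hasMoments_seqInc mX _), abs_div,
        abs_of_pos (two_pos : (0 : ℝ) < 2)]
      gcongr
      exact abs_add_le _ _
    refine (Finset.sum_le_sum hterm).trans ?_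
    rw [← Finset.sum_div, Finset.sum_add_distrib]
    simp only [Nat.succ_eq_add_one] at h2
    linarith
  simp only [Finset.sum_add_distrib, Finset.sum_const, Finset.card_range, nsmul_eq_mul, hdiag]
  rw [← Finset.mul_sum, ← Finset.mul_sum, sum_cbrtInc]
  have := Finset.sum_le_sum hoff
  simp only [Finset.sum_const, Finset.card_range, nsmul_eq_mul] at this
  have h0 : 0 ≤ m * (δ * absCbrt m) := by
    have := absCbrt_nonneg m
    positivity
  nlinarith

lemma integral_seqMid_sq_le [IsFiniteMeasure P] (hX : IsFBMGrid X δ P) (mX : ∀ i, HasMoments (X i) P)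
    (hδ : 0 ≤ δ) (q : ℕ) {i m : ℕ} (hi : i < m) :
    ∫ ω, seqMid (fun k => X k ω) q i ^ 2 ∂P ≤ δ * absCbrt m := by
  have mD : ∀ i, HasMoments (fun ω => (X (q + i) ω - X q ω) ^ 2 / 2) P := fun i =>
    (((mX _).sub (mX _)).pow 2).div_const 2
  have h : ∫ ω, seqMid (fun k => X k ω) q i ^ 2 ∂P
      ≤ ∫ ω, ((X (q + i) ω - X q ω) ^ 2 / 2 + (X (q + (i + 1)) ω - X q ω) ^ 2 / 2) ∂P := by
    refine integral_mono ((hasMoments_seqMid mX q i).pow 2).integrable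
      ((mD i).add (mD (i + 1))).integrable fun ω => ?_
    simp only [seqMid_eq]
    nlinarith [sq_nonneg ((X (q + i) ω - X q ω) - (X (q + (i + 1)) ω - X q ω))]
  rw [integral_add (mD i).integrable (mD (i + 1)).integrable, integral_div, integral_div,
    hX.integral_sub_sq mX, hX.integral_sub_sq mX] at h
  have h1 : absCbrt i ≤ absCbrt m := absCbrt_mono (Nat.cast_nonneg i) (by exact_mod_cast hi.le)
  have h2 : absCbrt ((i + 1 : ℕ) : ℝ) ≤ absCbrt m :=
    absCbrt_mono (Nat.cast_nonneg _) (by exact_mod_cast hi)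
  nlinarith

end IsFBMGrid

lemma seqInc_mem {Ω : Type*} {H : Submodule ℝ (Ω → ℝ)} {X : ℕ → Ω → ℝ}
    (hXH : ∀ i, X i ∈ H) (j : ℕ) : (fun ω => seqInc (fun k => X k ω) j) ∈ H :=
  H.sub_mem (hXH _) (hXH _)

lemma seqMid_mem {Ω : Type*} {H : Submodule ℝ (Ω → ℝ)} {X : ℕ → Ω → ℝ}
    (hXH : ∀ i, X i ∈ H) (q i : ℕ) : (fun ω => seqMid (fun k => X k ω) q i) ∈ H := by
  have : (fun ω => seqMid (fun k => X k ω) q i)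
      = (1 / 2 : ℝ) • (X (q + i) + X (q + i + 1)) - X q := by
    ext ω
    simp [seqMid]
    ring
  rw [this]
  exact H.sub_mem (H.smul_mem _ (H.add_mem (hXH _) (hXH _))) (hXH _)

namespace IsFBMGrid

variable {Ω : Type*} [MeasurableSpace Ω] {P : Measure Ω} [IsProbabilityMeasure P]
  {X : ℕ → Ω → ℝ}

lemma hasMoments_blockMajorant (mX : ∀ i, HasMoments (X i) P) (m : ℕ) (s μ : ℝ) (q : ℕ) :
    HasMoments (fun ω => blockMajorant (fun k => X k ω) m s μ q) P := by
  have mh := hasMoments_seqInc mX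
  have mW := hasMoments_seqMid mX
  exact (((HasMoments.const _).add
    (((HasMoments.sum _ fun i _ => (mh (q + i)).pow 5).pow 2).div_const μ)).add
    (((HasMoments.sum _ fun i _ => (mW q i).mul ((mh (q + i)).pow 5)).pow 2).div_const μ)).add
    (HasMoments.sum _ fun i _ => ((mW q i).pow 2).mul
      ((((mh (q + i)).pow 4).const_mul s).add (((mh (q + i)).pow 6).div_const s)))

lemma hasMoments_seqMajorant (mX : ∀ i, HasMoments (X i) P) (m M : ℕ) (s μ l : ℝ) :
    HasMoments (fun ω => seqMajorant (fun k => X k ω) m M s μ l) P := by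
  have mh := hasMoments_seqInc mX
  exact ((HasMoments.sum _ fun j _ => (((mh j).pow 6).const_mul s).add
      (((mh j).pow 8).div_const s)).add
    (HasMoments.sum _ fun p _ => hasMoments_blockMajorant mX m s μ (p * m))).add
    ((HasMoments.const _).add (HasMoments.sum _ fun j _ => ((mh j).pow 10).div_const l))

variable {H : Submodule ℝ (Ω → ℝ)} {σ : ℝ}

lemma integral_seqInc_pow_le (hX : IsFBMGrid X (σ ^ 2) P) (hH : IsGaussianSpace H P)
    (hXH : ∀ i, X i ∈ H) (hσ : 0 ≤ σ) (j k : ℕ) :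
    ∫ ω, seqInc (fun k => X k ω) j ^ k ∂P ≤ k.factorial * σ ^ k := by
  have hh := seqInc_mem hXH j
  have h2 := (hX.integral_seqInc_sq (fun i => hH.hasMoments (hXH i)) j).le
  have := hH.abs_integral_pow_mul_pow_mul_pow_le k k 0 0 rfl hh hh hh hσ hσ hσ h2 h2 h2
  simp only [pow_zero, mul_one] at this
  exact (le_abs_self _).trans this

lemma integral_seqMid_sq_mul_seqInc_pow_le (hX : IsFBMGrid X (σ ^ 2) P)
    (hH : IsGaussianSpace H P) (hXH : ∀ i, X i ∈ H) (hσ : 0 ≤ σ) (q : ℕ) {i m : ℕ} (hi : i < m)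
    (k : ℕ) :
    ∫ ω, seqMid (fun k => X k ω) q i ^ 2 * seqInc (fun k => X k ω) (q + i) ^ k ∂P
      ≤ (2 + k).factorial * (σ ^ 2 * absCbrt m * σ ^ k) := by
  have hh := seqInc_mem hXH (q + i)
  have hW := seqMid_mem hXH q i
  have h2 := (hX.integral_seqInc_sq (fun i => hH.hasMoments (hXH i)) (q + i)).le
  have hw0 : 0 ≤ σ ^ 2 * absCbrt m := mul_nonneg (sq_nonneg σ) (absCbrt_nonneg _)
  have hWw := (hX.integral_seqMid_sq_le (fun i => hH.hasMoments (hXH i)) (sq_nonneg σ) q hi).trans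
    (Real.sq_sqrt hw0).ge
  have := hH.abs_integral_pow_mul_pow_mul_pow_le (2 + k) 2 k 0 rfl hW hh hh (Real.sqrt_nonneg _)
    hσ hσ hWw h2 h2
  simp only [pow_zero, mul_one, Real.sq_sqrt hw0] at this
  exact (le_abs_self _).trans this

lemma integral_blockMajorant_le (hX : IsFBMGrid X (σ ^ 2) P) (hH : IsGaussianSpace H P)
    (hXH : ∀ i, X i ∈ H) (hσ : 0 ≤ σ) {m : ℕ} (hm : 0 < m) {s μ κ : ℝ} (hs : 0 < s) (hμ : 0 < μ)
    (hκ : σ ^ 2 * absCbrt m ≤ κ) (hκ4 : κ ≤ 4) (q : ℕ) :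
    ∫ ω, blockMajorant (fun k => X k ω) m s μ q ∂P
      ≤ 2 * μ + 650880 * m * σ ^ 10 / μ
        + (650880 * κ * m * σ ^ 10 + 145152000 * κ * m * σ ^ 9) / μ
        + m * (κ * (720 * s * σ ^ 4 + 40320 * σ ^ 6 / s)) := by
  have mX := fun i => hH.hasMoments (hXH i)
  have mh := fun i => hasMoments_seqInc mX (q + i)
  have mW := hasMoments_seqMid mX q
  have hκ0 : 0 ≤ κ := (mul_nonneg (sq_nonneg σ) (absCbrt_nonneg _)).trans hκ
  have hhH := fun i => seqInc_mem hXH (q + i)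
  have hWH := seqMid_mem hXH q
  have hσ2 := sq_nonneg σ
  have hw0 : 0 ≤ σ ^ 2 * absCbrt m := mul_nonneg hσ2 (absCbrt_nonneg _)
  have hh2 := fun i => (hX.integral_seqInc_sq mX (q + i)).le
  have hW2 := fun i (hi : i < m) =>
    (hX.integral_seqMid_sq_le mX hσ2 q hi).trans (Real.sq_sqrt hw0).ge
  have hw2 : √(σ ^ 2 * absCbrt m) ≤ 2 := by
    rw [Real.sqrt_le_left (by norm_num)]
    linarith
  have hS1 := hX.sum_abs_integral_seqInc_mul_le mX hσ2 q m
  have hS2 := hX.sum_abs_integral_seqMid_mul_le mX hσ2 q hm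
  have b1 : ∫ ω, (∑ i ∈ Finset.range m, seqInc (fun k => X k ω) (q + i) ^ 5) ^ 2 ∂P
      ≤ 650880 * m * σ ^ 10 := by
    refine (hH.integral_sum_pow_five_sq_le hhH hσ hh2).trans ?_
    calc _ ≤ 216960 * σ ^ 8 * (3 * m * σ ^ 2) := by gcongr
      _ = _ := by ring
  have b2 : ∫ ω, (∑ i ∈ Finset.range m,
      seqMid (fun k => X k ω) q i * seqInc (fun k => X k ω) (q + i) ^ 5) ^ 2 ∂P
      ≤ 650880 * κ * m * σ ^ 10 + 145152000 * κ * m * σ ^ 9 := by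
    refine (hH.integral_sum_mul_pow_five_sq_le hhH hWH (Real.sqrt_nonneg _) hσ hh2 hW2).trans ?_
    rw [Real.sq_sqrt hw0]
    calc _ ≤ 216960 * κ * σ ^ 8 * (3 * m * σ ^ 2)
          + 18144000 * 2 * σ ^ 9 * (4 * m * σ ^ 2 * absCbrt m) := by gcongr
      _ = 650880 * κ * m * σ ^ 10
          + 145152000 * (σ ^ 2 * absCbrt m) * m * σ ^ 9 := by ring
      _ ≤ _ := by gcongr
  have i3 : ∀ i, HasMoments (fun ω => seqMid (fun k => X k ω) q i ^ 2
      * (s * seqInc (fun k => X k ω) (q + i) ^ 4 + seqInc (fun k => X k ω) (q + i) ^ 6 / s)) P :=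
    fun i => ((mW i).pow 2).mul ((((mh i).pow 4).const_mul s).add (((mh i).pow 6).div_const s))
  have b3 : ∫ ω, (∑ i ∈ Finset.range m, seqMid (fun k => X k ω) q i ^ 2
      * (s * seqInc (fun k => X k ω) (q + i) ^ 4 + seqInc (fun k => X k ω) (q + i) ^ 6 / s)) ∂P
      ≤ m * (κ * (720 * s * σ ^ 4 + 40320 * σ ^ 6 / s)) := by
    rw [integral_finsetSum _ fun i _ => (i3 i).integrable]
    have : ∀ i ∈ Finset.range m, ∫ ω, seqMid (fun k => X k ω) q i ^ 2
        * (s * seqInc (fun k => X k ω) (q + i) ^ 4 + seqInc (fun k => X k ω) (q + i) ^ 6 / s) ∂P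
        ≤ κ * (720 * s * σ ^ 4 + 40320 * σ ^ 6 / s) := by
      intro i hi
      have hi' := Finset.mem_range.mp hi
      have h4 := hX.integral_seqMid_sq_mul_seqInc_pow_le hH hXH hσ q hi' 4
      have h6 := hX.integral_seqMid_sq_mul_seqInc_pow_le hH hXH hσ q hi' 6
      norm_num [Nat.factorial] at h4 h6
      have e : ∀ ω, seqMid (fun k => X k ω) q i ^ 2 * (s * seqInc (fun k => X k ω) (q + i) ^ 4
          + seqInc (fun k => X k ω) (q + i) ^ 6 / s)
          = s * (seqMid (fun k => X k ω) q i ^ 2 * seqInc (fun k => X k ω) (q + i) ^ 4)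
            + seqMid (fun k => X k ω) q i ^ 2 * seqInc (fun k => X k ω) (q + i) ^ 6 / s :=
        fun ω => by ring
      simp only [e]
      rw [integral_add ((((mW i).pow 2).mul ((mh i).pow 4)).const_mul s).integrable
        ((((mW i).pow 2).mul ((mh i).pow 6)).div_const s).integrable, integral_const_mul,
        integral_div]
      calc _ ≤ s * (720 * (σ ^ 2 * absCbrt m * σ ^ 4))
            + 40320 * (σ ^ 2 * absCbrt m * σ ^ 6) / s := by gcongr
        _ = (σ ^ 2 * absCbrt m) * (720 * s * σ ^ 4 + 40320 * σ ^ 6 / s) := by ring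
        _ ≤ _ := by gcongr
    refine (Finset.sum_le_sum this).trans (le_of_eq ?_)
    rw [Finset.sum_const, Finset.card_range, nsmul_eq_mul]
  have j1 := ((HasMoments.sum (Finset.range m) fun i _ => (mh i).pow 5).pow 2).div_const μ
  have j2 := ((HasMoments.sum (Finset.range m) fun i _ =>
    (mW i).mul ((mh i).pow 5)).pow 2).div_const μ
  have j3 := HasMoments.sum (Finset.range m) fun i _ => i3 i
  have j0 : HasMoments (fun _ : Ω => 2 * μ) P := HasMoments.const _
  simp only [blockMajorant]
  rw [integral_add ((j0.add j1).add j2).integrable j3.integrable,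
    integral_add (j0.add j1).integrable j2.integrable, integral_add j0.integrable j1.integrable,
    integral_div, integral_div, integral_const, probReal_univ, one_smul]
  gcongr

lemma integral_seqMajorant_le (hX : IsFBMGrid X (σ ^ 2) P) (hH : IsGaussianSpace H P)
    (hXH : ∀ i, X i ∈ H) (hσ : 0 ≤ σ) {m : ℕ} (hm : 0 < m) (M : ℕ) {s μ l κ : ℝ} (hs : 0 < s)
    (hμ : 0 < μ) (hl : 0 < l) (hκ : σ ^ 2 * absCbrt m ≤ κ) (hκ4 : κ ≤ 4) :
    ∫ ω, seqMajorant (fun k => X k ω) m M s μ l ∂P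
      ≤ M * (720 * s * σ ^ 6 + 40320 * σ ^ 8 / s)
        + (M / m : ℕ) * (2 * μ + 650880 * m * σ ^ 10 / μ
        + (650880 * κ * m * σ ^ 10 + 145152000 * κ * m * σ ^ 9) / μ
        + m * (κ * (720 * s * σ ^ 4 + 40320 * σ ^ 6 / s)))
        + (m * l + M * (3628800 * σ ^ 10 / l)) := by
  have mX := fun i => hH.hasMoments (hXH i)
  have mh := hasMoments_seqInc mX
  have mB := fun p => hasMoments_blockMajorant mX m s μ (p * m)
  have i1 : ∀ j, HasMoments (fun ω => s * seqInc (fun k => X k ω) j ^ 6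
      + seqInc (fun k => X k ω) j ^ 8 / s) P := fun j =>
    (((mh j).pow 6).const_mul s).add (((mh j).pow 8).div_const s)
  have i3 := fun j => ((mh j).pow 10).div_const l
  have jc : HasMoments (fun _ : Ω => m * l) P := HasMoments.const _
  have j1 := HasMoments.sum (Finset.range M) fun j _ => i1 j
  have j2 := HasMoments.sum (Finset.range (M / m)) fun p _ => mB p
  have j3 := HasMoments.sum (Finset.range M) fun j _ => i3 j
  have hp := fun j k => hX.integral_seqInc_pow_le hH hXH hσ j k
  simp only [seqMajorant]
  rw [integral_add (j1.add j2).integrable (jc.add j3).integrable,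
    integral_add j1.integrable j2.integrable, integral_add jc.integrable j3.integrable,
    integral_const, probReal_univ, one_smul, integral_finsetSum _ fun j _ => (i1 j).integrable,
    integral_finsetSum _ fun j _ => (mB j).integrable,
    integral_finsetSum _ fun j _ => (i3 j).integrable]
  refine add_le_add (add_le_add ?_ ?_) (add_le_add le_rfl ?_)
  · have : ∀ j ∈ Finset.range M, ∫ ω, (s * seqInc (fun k => X k ω) j ^ 6
        + seqInc (fun k => X k ω) j ^ 8 / s) ∂P ≤ 720 * s * σ ^ 6 + 40320 * σ ^ 8 / s := by
      intro j _
      have h6 := hp j 6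
      have h8 := hp j 8
      norm_num [Nat.factorial] at h6 h8
      rw [integral_add (((mh j).pow 6).const_mul s).integrable (((mh j).pow 8).div_const s).integrable,
        integral_const_mul, integral_div]
      calc _ ≤ s * (720 * σ ^ 6) + 40320 * σ ^ 8 / s := by gcongr
        _ = _ := by ring
    refine (Finset.sum_le_sum this).trans (le_of_eq ?_)
    rw [Finset.sum_const, Finset.card_range, nsmul_eq_mul]
  · refine (Finset.sum_le_sum fun p _ =>
      hX.integral_blockMajorant_le hH hXH hσ hm hs hμ hκ hκ4 (p * m)).trans (le_of_eq ?_)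
    rw [Finset.sum_const, Finset.card_range, nsmul_eq_mul]
  · have : ∀ j ∈ Finset.range M, ∫ ω, seqInc (fun k => X k ω) j ^ 10 / l ∂P
        ≤ 3628800 * σ ^ 10 / l := by
      intro j _
      have h10 := hp j 10
      norm_num [Nat.factorial] at h10
      rw [integral_div]
      gcongr
    refine (Finset.sum_le_sum this).trans (le_of_eq ?_)
    rw [Finset.sum_const, Finset.card_range, nsmul_eq_mul]

end IsFBMGrid

namespace IsFBM16

variable {Ω : Type*} [MeasureSpace Ω] {B : ℝ → Ω → ℝ}

lemma isGaussianSpace (hB : IsFBM16 B) :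
    IsGaussianSpace (Submodule.span ℝ (B '' Set.Ici 0)) (volume : Measure Ω) := by
  intro X hX
  obtain ⟨m, c, u, rfl⟩ := Submodule.mem_span_set'.mp hX
  choose t ht htu using fun i => (u i).2
  have e : (∑ i, c i • (u i : Ω → ℝ)) = fun ω => ∑ i, c i * B (t i) ω := by
    ext ω
    simp [Finset.sum_apply, htu]
  rw [e]
  exact ⟨Finset.measurable_sum _ fun i _ => (hB.1 _).const_mul _, hB.2.2.1 m t c ht⟩

lemma isFBMGrid (hB : IsFBM16 B) (n : ℕ) :
    IsFBMGrid (fun j ω => B ((j : ℝ) / n) ω) ((1 / (n : ℝ)) ^ ((1 : ℝ) / 3))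
      (volume : Measure Ω) := by
  intro i j
  have hn : (0 : ℝ) ≤ 1 / n := by positivity
  have hi : (0 : ℝ) ≤ i := by positivity
  have hj : (0 : ℝ) ≤ j := by positivity
  rw [hB.2.2.2 _ _ (by positivity) (by positivity), ← sub_div, div_eq_mul_one_div (j : ℝ),
    div_eq_mul_one_div (i : ℝ), div_eq_mul_one_div ((j : ℝ) - i), abs_mul, abs_of_nonneg hn,
    Real.mul_rpow hj hn, Real.mul_rpow hi hn, Real.mul_rpow (abs_nonneg _) hn, absCbrt, absCbrt,
    absCbrt, abs_of_nonneg hi, abs_of_nonneg hj, abs_sub_comm (j : ℝ)]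
  ring

/-- Paths are uniformly bounded on compact intervals with probability close to one. -/
lemma tendsto_measure_unbounded [IsFiniteMeasure (volume : Measure Ω)] (hB : IsFBM16 B) (T : ℝ) :
    Tendsto (fun K : ℕ => volume {ω : Ω | ∀ q : ℚ, 0 ≤ (q : ℝ) → (q : ℝ) ≤ T → |B q ω| ≤ K}ᶜ)
      atTop (𝓝 0) := by
  have hmeas : ∀ K : ℕ,
      MeasurableSet {ω : Ω | ∀ q : ℚ, 0 ≤ (q : ℝ) → (q : ℝ) ≤ T → |B q ω| ≤ K} := by
    intro K
    simp only [Set.ofPred_forall]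
    refine MeasurableSet.iInter fun q => MeasurableSet.iInter fun _ => MeasurableSet.iInter fun _ =>
      measurableSet_le ?_ measurable_const
    exact (hB.1 q).abs
  have hempty : ⋂ K : ℕ, {ω : Ω | ∀ q : ℚ, 0 ≤ (q : ℝ) → (q : ℝ) ≤ T → |B q ω| ≤ K}ᶜ = ∅ := by
    rw [← Set.compl_iUnion, Set.compl_empty_iff, Set.eq_univ_iff_forall]
    intro ω
    obtain ⟨C, hC⟩ := (isCompact_Icc (a := 0) (b := T)).exists_bound_of_continuousOn
      (hB.2.1 ω).continuousOn
    obtain ⟨K, hK⟩ := exists_nat_ge C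
    exact Set.mem_iUnion.mpr ⟨K, fun q h0 h1 => (hC q ⟨h0, h1⟩).trans hK⟩
  have := tendsto_measure_iInter_atTop (μ := (volume : Measure Ω))
    (s := fun K : ℕ => {ω : Ω | ∀ q : ℚ, 0 ≤ (q : ℝ) → (q : ℝ) ≤ T → |B q ω| ≤ K}ᶜ)
    (fun K => (hmeas K).compl.nullMeasurableSet)
    (fun K L hKL => Set.compl_subset_compl.mpr fun ω hω q h0 h1 =>
      (hω q h0 h1).trans (by exact_mod_cast hKL)) ⟨0, measure_ne_top _ _⟩
  rwa [hempty, measure_empty] at this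

lemma integral_seqMajorant_grid_le [IsProbabilityMeasure (volume : Measure Ω)] (hB : IsFBM16 B)
    {T : ℝ} (hT : 0 < T) {n : ℕ} (hn : 0 < n) {b : ℝ} (hb : b = (1 / (n : ℝ)) ^ ((1 : ℝ) / 36)) :
    ∫ ω, seqMajorant (fun k => B ((k : ℝ) / n) ω) ⌈(b ^ 15)⁻¹⌉₊ ⌊(n : ℝ) * T⌋₊ (b ^ 6) (b ^ 22)
      (b ^ 16) ≤ (1000000000 * T + 2) * b := by
  have hn' : (0 : ℝ) < n := by exact_mod_cast hn
  have hb0 : 0 < b := hb ▸ Real.rpow_pos_of_pos (by positivity) _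
  have hb1 : b ≤ 1 := by
    rw [hb]
    refine Real.rpow_le_one (by positivity) ?_ (by norm_num)
    rw [div_le_one hn']
    exact_mod_cast hn
  have hb36 : b ^ 36 = 1 / n := by
    rw [hb, ← Real.rpow_natCast, ← Real.rpow_mul (by positivity)]
    norm_num
  have hδ : (1 / (n : ℝ)) ^ ((1 : ℝ) / 3) = (b ^ 6) ^ 2 := by
    rw [hb, ← pow_mul, ← Real.rpow_natCast, ← Real.rpow_mul (by positivity)]
    norm_num
  set m := ⌈(b ^ 15)⁻¹⌉₊ with hmdef
  set M := ⌊(n : ℝ) * T⌋₊ with hMdef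
  have hb15 : 0 < b ^ 15 := by positivity
  have hm1 : (b ^ 15)⁻¹ ≤ m := Nat.le_ceil _
  have hm0 : 0 < m := Nat.ceil_pos.mpr (by positivity)
  have hm0' : (0 : ℝ) < m := by exact_mod_cast hm0
  have hm2 : m * b ^ 15 ≤ 2 := by
    have h1 : (m : ℝ) ≤ (b ^ 15)⁻¹ + 1 := (Nat.ceil_lt_add_one (by positivity)).le
    have h2 : b ^ 15 ≤ 1 := pow_le_one₀ hb0.le hb1
    calc (m : ℝ) * b ^ 15 ≤ ((b ^ 15)⁻¹ + 1) * b ^ 15 := by gcongr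
      _ = 1 + b ^ 15 := by field_simp
      _ ≤ 2 := by linarith
  have hMA : M * b ^ 36 ≤ T := by
    rw [hb36, mul_one_div, div_le_iff₀ hn', mul_comm T]
    exact Nat.floor_le (by positivity)
  have hQ : ((M / m : ℕ) : ℝ) * b ^ 21 ≤ T := by
    have h1 : ((M / m : ℕ) : ℝ) * m ≤ M := by exact_mod_cast Nat.div_mul_le_self M m
    have h2 : 1 ≤ m * b ^ 15 := by
      rwa [inv_eq_one_div, div_le_iff₀ hb15] at hm1
    calc ((M / m : ℕ) : ℝ) * b ^ 21 ≤ ((M / m : ℕ) : ℝ) * b ^ 21 * (m * b ^ 15) :=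
          le_mul_of_one_le_right (by positivity) h2
      _ = ((M / m : ℕ) : ℝ) * m * b ^ 36 := by ring
      _ ≤ M * b ^ 36 := by gcongr
      _ ≤ T := hMA
  have hκ : (b ^ 6) ^ 2 * absCbrt m ≤ 2 * b ^ 7 := by
    have h1 : absCbrt m ≤ 2 * (b ^ 5)⁻¹ := by
      have h8 : (m : ℝ) ≤ (2 * (b ^ 5)⁻¹) ^ 3 := by
        have : (2 * (b ^ 5)⁻¹) ^ 3 = 8 / b ^ 15 := by
          field_simp
          norm_num
        rw [this, le_div_iff₀ hb15]
        linarith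
      rw [absCbrt, abs_of_pos hm0']
      calc (m : ℝ) ^ ((1 : ℝ) / 3) ≤ ((2 * (b ^ 5)⁻¹) ^ 3) ^ ((1 : ℝ) / 3) := by gcongr
        _ = 2 * (b ^ 5)⁻¹ := by
          rw [← Real.rpow_natCast, ← Real.rpow_mul (by positivity)]
          norm_num
    calc (b ^ 6) ^ 2 * absCbrt m ≤ (b ^ 6) ^ 2 * (2 * (b ^ 5)⁻¹) := by gcongr
      _ = 2 * b ^ 7 := by field_simp
  have hκ4 : 2 * b ^ 7 ≤ 4 := by
    have : b ^ 7 ≤ 1 := pow_le_one₀ hb0.le hb1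
    linarith
  have hX := hB.isFBMGrid n
  rw [hδ] at hX
  have key := hX.integral_seqMajorant_le hB.isGaussianSpace
    (fun j => Submodule.subset_span ⟨(j : ℝ) / n, Set.mem_Ici.mpr (by positivity), rfl⟩)
    (by positivity) hm0 M (s := b ^ 6) (μ := b ^ 22) (l := b ^ 16) (by positivity) (by positivity)
    (by positivity) hκ hκ4
  refine key.trans ?_
  have hpow : ∀ k : ℕ, b ^ (k + 1) ≤ b := fun k => pow_le_of_le_one hb0.le hb1 (by omega)
  calc _ = 41040 * (M * b ^ 36) * b ^ (5 + 1) + 2 * ((M / m : ℕ) * b ^ 21) * b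
        + 650880 * ((M / m : ℕ) * b ^ 21) * (m * b ^ 15) * b ^ (1 + 1)
        + 1301760 * ((M / m : ℕ) * b ^ 21) * (m * b ^ 15) * b ^ (8 + 1)
        + 290304000 * ((M / m : ℕ) * b ^ 21) * (m * b ^ 15) * b ^ (2 + 1)
        + 82080 * ((M / m : ℕ) * b ^ 21) * (m * b ^ 15) * b
        + (m * b ^ 15) * b + 3628800 * (M * b ^ 36) * b ^ (7 + 1) := by
        field_simp
        ring
    _ ≤ 41040 * T * b + 2 * T * b + 650880 * T * 2 * b + 1301760 * T * 2 * b
        + 290304000 * T * 2 * b + 82080 * T * 2 * b + 2 * b + 3628800 * T * b := by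
        gcongr <;> exact hpow _
    _ ≤ (1000000000 * T + 2) * b := by nlinarith [mul_pos hT hb0]

end IsFBM16

lemma seqMajorant_nonneg (x : ℕ → ℝ) (m M : ℕ) {s μ l : ℝ} (hs : 0 < s) (hμ : 0 < μ)
    (hl : 0 < l) : 0 ≤ seqMajorant x m M s μ l := by
  have h6 : ∀ j, 0 ≤ seqInc x j ^ 6 := fun j => by positivity
  have h8 : ∀ j, 0 ≤ seqInc x j ^ 8 := fun j => by positivity
  have h10 : ∀ j, 0 ≤ seqInc x j ^ 10 := fun j => by positivity
  refine add_nonneg (add_nonneg (Finset.sum_nonneg fun j _ => ?_)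
    (Finset.sum_nonneg fun p _ => blockMajorant_nonneg x m hs hμ _))
    (add_nonneg (by positivity) (Finset.sum_nonneg fun j _ => div_nonneg (h10 j) hl.le))
  exact add_nonneg (mul_nonneg hs.le (h6 j)) (div_nonneg (h8 j) hs.le)

lemma sum_Icc_grid (N n : ℕ) (F : ℝ → ℝ → ℝ) :
    ∑ j ∈ Finset.Icc 1 N, F (((j : ℝ) - 1) / n) ((j : ℝ) / n)
      = ∑ j ∈ Finset.range N, F ((j : ℝ) / n) (((j + 1 : ℕ) : ℝ) / n) := by
  induction N with
  | zero => simp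
  | succ N ih =>
    rw [Finset.sum_Icc_succ_top (by omega), Finset.sum_range_succ, ih]
    push_cast
    rw [add_sub_cancel_right]

/-- On the event that the path is bounded by `K`, the uniform error of the change-of-variable
formula is controlled by the majorant along the grid. -/
lemma iSup_error_le {Ω : Type*} {B : ℝ → Ω → ℝ} {f g Φ : ℝ → ℝ} {K C : ℝ} (hC0 : 0 ≤ C)
    (hC : ∀ (x : ℕ → ℝ) (m M N : ℕ) (s μ l : ℝ), 0 < m → 0 < s → 0 < μ → 0 < l →
      N ≤ M → (∀ j ≤ M, |x j| ≤ K) →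
      |(∑ j ∈ Finset.range N, (f (x j) + f (x (j + 1))) / 2 * (g (x (j + 1)) - g (x j)))
        - Φ (x N) + Φ (x 0)
        - 1 / 12 * ∑ j ∈ Finset.range N,
          (iteratedDeriv 2 f ((x j + x (j + 1)) / 2) * deriv g ((x j + x (j + 1)) / 2)
            - deriv f ((x j + x (j + 1)) / 2) * iteratedDeriv 2 g ((x j + x (j + 1)) / 2))
            * (x (j + 1) - x j) ^ 3|
        ≤ C * seqMajorant x m M s μ l)
    {T : ℝ} (hT : 0 < T) {n : ℕ} (hn : 0 < n) {ω : Ω}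
    (hω : ∀ q : ℚ, 0 ≤ (q : ℝ) → (q : ℝ) ≤ T → |B q ω| ≤ K)
    {m : ℕ} {s μ l : ℝ} (hm : 0 < m) (hs : 0 < s) (hμ : 0 < μ) (hl : 0 < l) :
    ⨆ t ∈ Set.Icc (0 : ℝ) T,
        |(∑ j ∈ Finset.Icc 1 ⌊(n : ℝ) * t⌋₊,
            ((f (B (((j : ℝ) - 1) / n) ω) + f (B ((j : ℝ) / n) ω)) / 2) *
              (g (B ((j : ℝ) / n) ω) - g (B (((j : ℝ) - 1) / n) ω)))
          - Φ (B ((⌊(n : ℝ) * t⌋₊ : ℝ) / n) ω) + Φ (B 0 ω)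
          - (1 / 12) *
              ∑ j ∈ Finset.Icc 1 ⌊(n : ℝ) * t⌋₊,
                (iteratedDeriv 2 f ((B (((j : ℝ) - 1) / n) ω + B ((j : ℝ) / n) ω) / 2) *
                    deriv g ((B (((j : ℝ) - 1) / n) ω + B ((j : ℝ) / n) ω) / 2)
                  - deriv f ((B (((j : ℝ) - 1) / n) ω + B ((j : ℝ) / n) ω) / 2) *
                    iteratedDeriv 2 g
                      ((B (((j : ℝ) - 1) / n) ω + B ((j : ℝ) / n) ω) / 2)) *
                (B ((j : ℝ) / n) ω - B (((j : ℝ) - 1) / n) ω) ^ 3|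
      ≤ C * seqMajorant (fun k => B ((k : ℝ) / n) ω) m ⌊(n : ℝ) * T⌋₊ s μ l := by
  have hn' : (0 : ℝ) < n := by exact_mod_cast hn
  have h0 : 0 ≤ C * seqMajorant (fun k => B ((k : ℝ) / n) ω) m ⌊(n : ℝ) * T⌋₊ s μ l :=
    mul_nonneg hC0 (seqMajorant_nonneg _ _ _ hs hμ hl)
  refine Real.iSup_le (fun t => Real.iSup_le (fun ht => ?_) h0) h0
  have hN : ⌊(n : ℝ) * t⌋₊ ≤ ⌊(n : ℝ) * T⌋₊ :=
    Nat.floor_le_floor (mul_le_mul_of_nonneg_left ht.2 hn'.le)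
  have hx : ∀ j ≤ ⌊(n : ℝ) * T⌋₊, |B ((j : ℝ) / n) ω| ≤ K := by
    intro j hj
    have hjT : (j : ℝ) ≤ n * T := (Nat.le_floor_iff (by positivity)).mp hj
    have := hω ((j : ℚ) / n) (by push_cast; positivity)
      (by push_cast; rw [div_le_iff₀ hn']; linarith)
    simpa using this
  have key := hC (fun k => B ((k : ℝ) / n) ω) m _ _ s μ l hm hs hμ hl hN hx
  rw [sum_Icc_grid _ n fun u v => (f (B u ω) + f (B v ω)) / 2 * (g (B v ω) - g (B u ω)),
    sum_Icc_grid _ n fun u v =>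
      (iteratedDeriv 2 f ((B u ω + B v ω) / 2) * deriv g ((B u ω + B v ω) / 2)
        - deriv f ((B u ω + B v ω) / 2) * iteratedDeriv 2 g ((B u ω + B v ω) / 2))
        * (B v ω - B u ω) ^ 3]
  simpa only [Nat.cast_zero, zero_div] using key

/-- Change-of-variable formula
`∫ X dY = Φ(B) + (1/12) ∫ (f''g' - f'g'')(B) d⟦B⟧` at the level of Riemann-sum
representatives, where `X = f(B)`, `Y = g(B)`, and `Φ' = f g'`, `Φ(0) = 0`. -/
theorem stmt15 {Ω : Type*} [MeasureSpace Ω] [IsProbabilityMeasure (volume : Measure Ω)]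
    (B : ℝ → Ω → ℝ) (hB : IsFBM16 B)
    (f g Φ : ℝ → ℝ) (hf : ContDiff ℝ (⊤ : ℕ∞) f) (hg : ContDiff ℝ (⊤ : ℕ∞) g) (hΦ : ContDiff ℝ (⊤ : ℕ∞) Φ)
    (hΦ' : ∀ x, deriv Φ x = f x * deriv g x) (hΦ0 : Φ 0 = 0) :
    ∀ T > (0 : ℝ), ∀ ε > (0 : ℝ),
      Tendsto (fun n : ℕ =>
          volume {ω : Ω | ε ≤
            ⨆ t ∈ Set.Icc (0 : ℝ) T,
              |(∑ j ∈ Finset.Icc 1 ⌊(n : ℝ) * t⌋₊,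
                  ((f (B (((j : ℝ) - 1) / n) ω) + f (B ((j : ℝ) / n) ω)) / 2) *
                    (g (B ((j : ℝ) / n) ω) - g (B (((j : ℝ) - 1) / n) ω)))
                - Φ (B ((⌊(n : ℝ) * t⌋₊ : ℝ) / n) ω) + Φ (B 0 ω)
                - (1 / 12) *
                    ∑ j ∈ Finset.Icc 1 ⌊(n : ℝ) * t⌋₊,
                      (iteratedDeriv 2 f ((B (((j : ℝ) - 1) / n) ω + B ((j : ℝ) / n) ω) / 2) *
                          deriv g ((B (((j : ℝ) - 1) / n) ω + B ((j : ℝ) / n) ω) / 2)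
                        - deriv f ((B (((j : ℝ) - 1) / n) ω + B ((j : ℝ) / n) ω) / 2) *
                          iteratedDeriv 2 g
                            ((B (((j : ℝ) - 1) / n) ω + B ((j : ℝ) / n) ω) / 2)) *
                      (B ((j : ℝ) / n) ω - B (((j : ℝ) - 1) / n) ω) ^ 3|})
        atTop (𝓝 0) := by
  intro T hT ε hε
  rw [ENNReal.tendsto_nhds_zero]
  intro η hη
  obtain ⟨K, hK⟩ := ((ENNReal.tendsto_nhds_zero.mp (hB.tendsto_measure_unbounded T)) (η / 2)
    (ENNReal.half_pos hη.ne')).exists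
  obtain ⟨C, hC0, hC⟩ := exists_error_bound hf hg hΦ hΦ' K
  have hb0 : Tendsto (fun n : ℕ => (1 / (n : ℝ)) ^ ((1 : ℝ) / 36)) atTop (𝓝 0) := by
    have := tendsto_one_div_atTop_nhds_zero_nat.rpow_const (p := (1 : ℝ) / 36)
      (Or.inr (by norm_num))
    rwa [Real.zero_rpow (by norm_num)] at this
  have hlim : Tendsto (fun n : ℕ => ENNReal.ofReal
      (C * ((1000000000 * T + 2) * (1 / (n : ℝ)) ^ ((1 : ℝ) / 36)) / ε)) atTop (𝓝 0) := by
    have := ENNReal.tendsto_ofReal (((hb0.const_mul (1000000000 * T + 2)).const_mul C).div_const ε)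
    simpa using this
  filter_upwards [(ENNReal.tendsto_nhds_zero.mp hlim) (η / 2) (ENNReal.half_pos hη.ne'),
    eventually_gt_atTop 0] with n hnη hn
  have hn' : (0 : ℝ) < n := by exact_mod_cast hn
  obtain ⟨b, hb⟩ : ∃ b, b = (1 / (n : ℝ)) ^ ((1 : ℝ) / 36) := ⟨_, rfl⟩
  have hbpos : 0 < b := hb ▸ Real.rpow_pos_of_pos (by positivity) _
  set Z : Ω → ℝ := fun ω => seqMajorant (fun k => B ((k : ℝ) / n) ω) ⌈(b ^ 15)⁻¹⌉₊
    ⌊(n : ℝ) * T⌋₊ (b ^ 6) (b ^ 22) (b ^ 16) with hZ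
  have hZ0 : ∀ ω, 0 ≤ Z ω := fun ω =>
    seqMajorant_nonneg _ _ _ (by positivity) (by positivity) (by positivity)
  have hZint : Integrable Z volume :=
    (IsFBMGrid.hasMoments_seqMajorant (fun j : ℕ => hB.isGaussianSpace.hasMoments
      (Submodule.subset_span ⟨(j : ℝ) / n, Set.mem_Ici.mpr (by positivity), rfl⟩))
      _ _ _ _ _).integrable
  have hmarkov : volume {ω | ε ≤ C * Z ω} ≤ η / 2 := by
    have h1 := mul_meas_ge_le_integral_of_nonneg (μ := volume)
      (Eventually.of_forall fun ω => mul_nonneg hC0 (hZ0 ω)) (hZint.const_mul C) ε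
    rw [integral_const_mul] at h1
    have h2 := mul_le_mul_of_nonneg_left (hB.integral_seqMajorant_grid_le hT hn hb) hC0
    refine le_trans ?_ hnη
    rw [← hb, ← ofReal_measureReal]
    refine ENNReal.ofReal_le_ofReal ?_
    rw [le_div_iff₀ hε, mul_comm]
    exact h1.trans h2
  calc _ ≤ volume ({ω : Ω | ∀ q : ℚ, 0 ≤ (q : ℝ) → (q : ℝ) ≤ T → |B q ω| ≤ K}ᶜ
          ∪ {ω | ε ≤ C * Z ω}) := by
        refine measure_mono fun ω hω => ?_
        by_cases hmem : ∀ q : ℚ, 0 ≤ (q : ℝ) → (q : ℝ) ≤ T → |B q ω| ≤ K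
        · exact Or.inr (le_trans hω (iSup_error_le hC0 hC hT hn hmem
            (Nat.ceil_pos.mpr (by positivity)) (by positivity) (by positivity) (by positivity)))
        · exact Or.inl hmem
    _ ≤ η / 2 + η / 2 := (measure_union_le _ _).trans (add_le_add hK hmarkov)
    _ = η := ENNReal.add_halves η
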